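/- arXiv:2504.15907 — 3 statements merged into one kernel-verified Lean document; each statement's English description precedes it below -/
import Mathlib

section
/- An entire function f satisfies f(z)² − (f'(z))² = (1/2)e^{2iz} + (1/2)e^{−2iz} for all z ∈ ℂ if and only if f = cos z, f = −cos z, f = i·sin z, or f = −i·sin z. -/
open Complex

open Filter Topology Metric

lemma norm_logDeriv_center_le {k : ℂ → ℂ} {c : ℂ} {R A : ℝ} (hR : 0 < R) (hA : 1 < A)
    (hk : DifferentiableOn ℂ k (ball c R)) (h0 : ∀ z ∈ ball c R, k z ≠ 0)
    (hb : ∀ z ∈ ball c R, ‖k z‖ ≤ A * ‖k c‖) :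
    ‖deriv k c / k c‖ ≤ 4 * Real.log A / R := by
  have hc : c ∈ ball c R := mem_ball_self hR
  have hkd : ∀ z ∈ ball c R, HasDerivAt k (deriv k z) z := fun z hz =>
    (hk.differentiableAt (isOpen_ball.mem_nhds hz)).hasDerivAt
  have hq : DifferentiableOn ℂ (fun z => deriv k z / k z) (ball c R) :=
    (hk.deriv isOpen_ball).div hk h0
  obtain ⟨G, hGc, hG⟩ := hq.isExactOn_ball.with_val_at c 0
  have hder : ∀ z ∈ ball c R, HasDerivAt (fun z => k z * exp (-G z)) 0 z := fun z hz => by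
    have hz0 := h0 z hz
    refine ((hkd z hz).mul (hG z hz).neg.cexp).congr_deriv ?_
    field_simp
    ring
  have hconst : ∀ z ∈ ball c R, k z = k c * exp (G z) := fun z hz => by
    have := isOpen_ball.is_const_of_deriv_eq_zero (convex_ball c R).isPreconnected
      (fun w hw => (hder w hw).differentiableAt.differentiableWithinAt)
      (fun w hw => (hder w hw).deriv) hz hc
    simp only [hGc, neg_zero, exp_zero, mul_one] at this
    rw [← this, mul_assoc, ← exp_add]
    simp
  have hre : ∀ z ∈ ball c R, (G z).re ≤ Real.log A := fun z hz => by
    have h := hb z hz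
    rw [hconst z hz, norm_mul, norm_exp, mul_comm] at h
    have := le_of_mul_le_mul_right h (norm_pos_iff.2 (h0 c hc))
    exact (Real.le_log_iff_exp_le (by linarith)).2 this
  have hmem : ∀ w ∈ ball (0 : ℂ) R, c + w ∈ ball c R := fun w hw => by simpa using hw
  have hM := Real.log_pos hA
  have hGd : DifferentiableOn ℂ G (ball c R) := fun z hz =>
    (hG z hz).differentiableAt.differentiableWithinAt
  have hsph : ∀ z ∈ sphere c (R / 2), ‖G z‖ ≤ 2 * Real.log A := fun z hz => by
    have hz' : ‖z - c‖ = R / 2 := by simpa [dist_eq_norm] using hz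
    have := borelCaratheodory_zero (f := fun w => G (c + w)) (z := z - c) hM
      (hGd.comp (by fun_prop) hmem) (fun w hw => hre _ (hmem w hw)) hR
      (by simp [hz']; linarith) (by simpa using hGc)
    simp only [hz', add_sub_cancel] at this
    convert this using 1
    field_simp
    ring
  have hsub : closedBall c (R / 2) ⊆ ball c R := closedBall_subset_ball (by linarith)
  have := norm_deriv_le_of_forall_mem_sphere_norm_le (by positivity : 0 < R / 2)
    ((hGd.mono hsub).diffContOnCl_ball subset_rfl) hsph
  rw [(hG c hc).deriv] at this
  convert this using 1
  field_simp
  ring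

/-- `F` grows at most like `(1 + ‖z‖) * exp ‖z‖`. -/
def UnitType (F : ℂ → ℂ) : Prop :=
  ∃ A : ℝ, 0 < A ∧ ∀ z, ‖F z‖ ≤ A * ((1 + ‖z‖) * Real.exp ‖z‖)

lemma UnitType.add {F G : ℂ → ℂ} (hF : UnitType F) (hG : UnitType G) :
    UnitType (fun z => F z + G z) := by
  obtain ⟨A, hA, hF⟩ := hF
  obtain ⟨B, hB, hG⟩ := hG
  refine ⟨A + B, by positivity, fun z => ?_⟩
  linarith [norm_add_le (F z) (G z), hF z, hG z]

lemma UnitType.neg {F : ℂ → ℂ} (hF : UnitType F) : UnitType (fun z => -F z) := by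
  simpa [UnitType] using hF

lemma UnitType.deriv {F : ℂ → ℂ} (hd : Differentiable ℂ F) (hF : UnitType F) :
    UnitType (deriv F) := by
  obtain ⟨A, hA, hF⟩ := hF
  refine ⟨A * (2 * Real.exp 1), by positivity, fun z => ?_⟩
  have := norm_deriv_le_of_forall_mem_sphere_norm_le (c := z) one_pos hd.diffContOnCl
    (C := A * ((2 + ‖z‖) * Real.exp (‖z‖ + 1))) (fun w hw => by
      have hw' : ‖w‖ ≤ ‖z‖ + 1 := by
        have h1 : ‖w - z‖ = 1 := by simpa [dist_eq_norm] using hw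
        have := norm_add_le z (w - z)
        rw [add_sub_cancel, h1] at this
        exact this
      exact (hF w).trans (mul_le_mul_of_nonneg_left (mul_le_mul (by linarith)
        (Real.exp_le_exp.2 hw') (Real.exp_nonneg _) (by positivity)) hA.le))
  rw [div_one, Real.exp_add] at this
  refine this.trans ?_
  have h : 0 ≤ A * (Real.exp 1 * Real.exp ‖z‖) := by positivity
  nlinarith [norm_nonneg z, mul_nonneg h (norm_nonneg z)]

lemma unitType_of_norm_deriv_le {F : ℂ → ℂ} (hd : Differentiable ℂ F)
    (h : ∀ z, ‖deriv F z‖ ≤ ‖F z‖ + Real.exp ‖z‖) : UnitType F := by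
  refine ⟨‖F 0‖ + 2, by positivity, fun z => ?_⟩
  have hray : ‖F z‖ ≤ (‖F 0‖ + 2 * ‖z‖) * Real.exp ‖z‖ := by
    rcases eq_or_ne z 0 with rfl | hz
    · simp
    have hn : 0 < ‖z‖ := norm_pos_iff.2 hz
    set ζ : ℂ := z / ‖z‖ with hζ
    have hζ1 : ‖ζ‖ = 1 := by simp [hζ, hn.ne']
    have hline : ∀ t : ℝ, HasDerivAt (fun t : ℝ => F (t * ζ)) (deriv F (t * ζ) * ζ) t :=
      fun t => by
        have h1 : HasDerivAt (fun t : ℝ => (t : ℂ) * ζ) ζ t := by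
          simpa using (ofRealCLM.hasDerivAt (x := t)).mul_const ζ
        exact (hd _).hasDerivAt.comp t h1
    have hB : ∀ t : ℝ, HasDerivAt (fun t : ℝ => (‖F 0‖ + 2 * t) * Real.exp t)
        (2 * Real.exp t + (‖F 0‖ + 2 * t) * Real.exp t) t := fun t => by
      have h1 : HasDerivAt (fun t : ℝ => ‖F 0‖ + 2 * t) 2 t := by
        simpa using ((hasDerivAt_id t).const_mul 2).const_add ‖F 0‖
      exact h1.mul (Real.hasDerivAt_exp t)
    have := image_norm_le_of_norm_deriv_right_lt_deriv_boundary (a := 0) (b := ‖z‖)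
      (fun t _ => (hline t).continuousAt.continuousWithinAt)
      (fun t _ => (hline t).hasDerivWithinAt) (by simp) hB
      (fun t ht hFt => by
        have ht' := h (t * ζ)
        rw [norm_mul, hζ1, mul_one, norm_real, Real.norm_of_nonneg ht.1, hFt] at ht'
        rw [norm_mul, hζ1, mul_one]
        linarith [Real.exp_pos t])
      (Set.right_mem_Icc.2 hn.le)
    rwa [hζ, mul_div_cancel₀ _ (by exact_mod_cast hn.ne')] at this
  refine hray.trans ?_
  rw [← mul_assoc]
  gcongr
  nlinarith [norm_nonneg z, norm_nonneg (F 0), mul_nonneg (norm_nonneg (F 0)) (norm_nonneg z)]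

lemma cos_two_mul_ne_zero {z : ℂ} (hz : 0 < z.im) : Complex.cos (2 * z) ≠ 0 := by
  rw [Complex.cos_ne_zero_iff]
  intro k h
  have h1 : (2 * z).im = 2 * z.im := by simp
  have h2 : ((2 * (k : ℂ) + 1) * Real.pi / 2).im = 0 := by
    have : ((2 * (k : ℂ) + 1) * Real.pi / 2) = (((2 * (k : ℝ) + 1) * Real.pi / 2 : ℝ) : ℂ) := by
      push_cast; rfl
    rw [this, ofReal_im]
  rw [h, h2] at h1
  linarith

lemma tendsto_logDeriv_imaginary_axis {u v : ℂ → ℂ} (hu : Differentiable ℂ u) (hut : UnitType u)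
    (hvt : UnitType v) (huv : ∀ z, u z * v z = Complex.cos (2 * z)) :
    Tendsto (fun y : ℝ => deriv u (y * I) / u (y * I)) atTop (𝓝 (-I)) := by
  obtain ⟨A, hA, hut⟩ := hut
  obtain ⟨B, hB, hvt⟩ := hvt
  rw [Metric.tendsto_nhds]
  intro ε hε
  set δ : ℝ := min (1 / 2) (ε / 16) with hδ
  have hδ0 : 0 < δ := by positivity
  have hδ1 : δ ≤ 1 / 2 := min_le_left _ _
  have hδε : δ ≤ ε / 16 := min_le_right _ _
  have hc : 0 < 1 / (18 * A * B) := by positivity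
  filter_upwards [(isLittleO_pow_exp_pos_mul_atTop 2 (pow_pos hδ0 2)).bound hc,
    eventually_ge_atTop 1] with y hy hy1
  have hy0 : 0 < y := by linarith
  rw [Real.norm_of_nonneg (by positivity), Real.norm_of_nonneg (by positivity),
    div_mul_eq_mul_div, one_mul, le_div_iff₀ (by positivity)] at hy
  have hpoly : 2 * A * B * (1 + 2 * y) ^ 2 ≤ Real.exp (δ ^ 2 * y) := by
    refine le_trans ?_ hy
    have : (1 + 2 * y) ^ 2 ≤ 9 * y ^ 2 := by nlinarith
    nlinarith [mul_le_mul_of_nonneg_left this (by positivity : 0 ≤ 2 * A * B)]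
  set c : ℂ := y * I with hcdef
  have hcn : ‖c‖ = y := by simp [c, abs_of_pos hy0]
  have hcim : c.im = y := by simp [c]
  have hcre : c.re = 0 := by simp [c]
  set k : ℂ → ℂ := fun z => u z * exp (I * z) with hk
  have hkn : ∀ z, ‖k z‖ = ‖u z‖ * Real.exp (-z.im) := fun z => by simp [k, norm_exp]
  have hball : ∀ z ∈ ball c (δ * y), 0 < z.im ∧ ‖z‖ ≤ 2 * y ∧ ‖z‖ - z.im ≤ δ ^ 2 * y := by
    intro z hz
    have hz' : ‖z - c‖ < δ * y := by simpa [dist_eq_norm] using hz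
    have hre : |z.re| < δ * y := by
      have := (abs_re_le_norm (z - c)).trans_lt hz'
      simpa [hcre] using this
    have him : |z.im - y| < δ * y := by
      have := (abs_im_le_norm (z - c)).trans_lt hz'
      simpa [hcim] using this
    have hdy : δ * y ≤ y / 2 := by nlinarith
    have him1 : y / 2 ≤ z.im := by linarith [(abs_lt.1 him).1]
    have hzn : z.im ≤ ‖z‖ := (le_abs_self _).trans (abs_im_le_norm z)
    refine ⟨by linarith, ?_, ?_⟩
    · have := norm_add_le c (z - c)
      rw [add_sub_cancel, hcn] at this
      linarith
    · have hsq : ‖z‖ ^ 2 = z.re ^ 2 + z.im ^ 2 := by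
        rw [Complex.sq_norm, normSq_apply]; ring
      have hre2 : z.re ^ 2 ≤ (δ * y) ^ 2 := sq_le_sq' (abs_lt.1 hre).1.le (abs_lt.1 hre).2.le
      by_contra! hlt
      have h1 : 0 ≤ δ ^ 2 * y := by positivity
      nlinarith [mul_lt_mul_of_pos_right hlt hy0, mul_le_mul_of_nonneg_left
        (by linarith : y ≤ ‖z‖ + z.im) (h1.trans hlt.le)]
  have hune : ∀ z : ℂ, 0 < z.im → u z ≠ 0 := fun z hz h =>
    cos_two_mul_ne_zero hz (by rw [← huv, h, zero_mul])
  have hkc : 1 ≤ 2 * B * (1 + y) * ‖k c‖ := by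
    have h1 : Real.exp (2 * y) / 2 ≤ ‖u c‖ * ‖v c‖ := by
      rw [← norm_mul, huv, hcdef, ← mul_assoc, cos_mul_I]
      rw [show (2 * (y : ℂ)) = ((2 * y : ℝ) : ℂ) by push_cast; rfl, ← ofReal_cosh, norm_real,
        Real.norm_of_nonneg (Real.cosh_pos _).le, Real.cosh_eq]
      linarith [Real.exp_pos (-(2 * y))]
    have h2 := mul_le_mul_of_nonneg_left (hvt c) (norm_nonneg (u c))
    rw [hcn] at h2
    rw [hkn, hcim, Real.exp_neg]
    have he : Real.exp (2 * y) = Real.exp y * Real.exp y := by rw [← Real.exp_add]; ring_nf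
    have hey := Real.exp_pos y
    rw [he] at h1
    have h3 : Real.exp y * Real.exp y ≤ Real.exp y * (2 * B * (1 + y) * ‖u c‖) := by nlinarith
    have h4 := le_of_mul_le_mul_left h3 hey
    rw [← mul_assoc, ← div_eq_mul_inv, le_div_iff₀ hey]
    linarith
  have hkd : Differentiable ℂ k := by fun_prop
  have hmain := norm_logDeriv_center_le (k := k) (c := c) (R := δ * y)
    (A := Real.exp (2 * (δ ^ 2 * y))) (by positivity) (Real.one_lt_exp_iff.2 (by positivity))
    hkd.differentiableOn
    (fun z hz => mul_ne_zero (hune z (hball z hz).1) (exp_ne_zero _))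
    (fun z hz => by
      obtain ⟨_, hz2, hz3⟩ := hball z hz
      have h1 : ‖k z‖ ≤ A * (1 + 2 * y) * Real.exp (δ ^ 2 * y) := by
        rw [hkn]
        calc ‖u z‖ * Real.exp (-z.im)
            ≤ A * ((1 + ‖z‖) * Real.exp ‖z‖) * Real.exp (-z.im) := by gcongr; exact hut z
          _ = A * (1 + ‖z‖) * Real.exp (‖z‖ - z.im) := by
            rw [sub_eq_add_neg, Real.exp_add]; ring
          _ ≤ A * (1 + 2 * y) * Real.exp (δ ^ 2 * y) := by gcongr
      have h2 : A * (1 + 2 * y) ≤ Real.exp (δ ^ 2 * y) * ‖k c‖ := by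
        calc A * (1 + 2 * y) ≤ A * (1 + 2 * y) * (2 * B * (1 + y) * ‖k c‖) :=
              le_mul_of_one_le_right (by positivity) hkc
          _ ≤ A * (1 + 2 * y) * (2 * B * (1 + 2 * y) * ‖k c‖) := by gcongr; linarith
          _ = 2 * A * B * (1 + 2 * y) ^ 2 * ‖k c‖ := by ring
          _ ≤ _ := by gcongr
      calc ‖k z‖ ≤ _ := h1
        _ ≤ Real.exp (δ ^ 2 * y) * ‖k c‖ * Real.exp (δ ^ 2 * y) := by gcongr
        _ = _ := by rw [two_mul, Real.exp_add]; ring)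
  have hlog : deriv k c / k c = deriv u c / u c + I := by
    have h1 : HasDerivAt (fun z : ℂ => exp (I * z)) (exp (I * c) * I) c := by
      simpa using ((hasDerivAt_id c).const_mul I).cexp
    have h2 : deriv k c = deriv u c * exp (I * c) + u c * (exp (I * c) * I) :=
      ((hu c).hasDerivAt.mul h1).deriv
    have h3 := hune c (by rw [hcim]; exact hy0)
    have h4 := exp_ne_zero (I * c)
    rw [h2, hk]
    field_simp
  rw [hlog, Real.log_exp] at hmain
  rw [dist_eq_norm, sub_neg_eq_add]
  refine hmain.trans_lt ?_
  rw [div_lt_iff₀ (by positivity)]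
  nlinarith [mul_pos hδ0 hy0]

lemma tendsto_tan_imaginary_axis :
    Tendsto (fun y : ℝ => Complex.sin (2 * (y * I)) / Complex.cos (2 * (y * I))) atTop (𝓝 I) := by
  have h : Tendsto (fun y : ℝ => Real.exp (-(4 * y))) atTop (𝓝 0) :=
    Real.tendsto_exp_neg_atTop_nhds_zero.comp (tendsto_id.const_mul_atTop (by norm_num))
  have h1 : Tendsto (fun y : ℝ => (1 - Real.exp (-(4 * y))) / (1 + Real.exp (-(4 * y))))
      atTop (𝓝 1) := by
    have := (h.const_sub 1).div (h.const_add 1) (by norm_num)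
    simp only [sub_zero, add_zero, div_one] at this
    exact this
  have h2 := ((continuous_ofReal.tendsto _).comp h1).mul_const I
  simp only [ofReal_one, one_mul] at h2
  refine h2.congr fun y => ?_
  have h3 : Real.sinh (2 * y) / Real.cosh (2 * y)
      = (1 - Real.exp (-(4 * y))) / (1 + Real.exp (-(4 * y))) := by
    rw [Real.sinh_eq, Real.cosh_eq,
      show -(4 * y) = -(2 * y) + -(2 * y) by ring, Real.exp_add, Real.exp_neg]
    have := Real.exp_pos (2 * y)
    field_simp
  rw [← mul_assoc, sin_mul_I, cos_mul_I]
  simp only [Function.comp, ← h3]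
  push_cast
  ring

lemma tendsto_ratio_imaginary_axis {f : ℂ → ℂ} (hf : Differentiable ℂ f)
    (hE : ∀ z, f z ^ 2 - deriv f z ^ 2 = Complex.cos (2 * z)) (hft : UnitType f) :
    Tendsto (fun y : ℝ => (2 * f (y * I) - deriv (deriv f) (y * I)) / deriv f (y * I))
      atTop (𝓝 (3 * I)) := by
  have hf1 : Differentiable ℂ (deriv f) := hf.deriv
  set u : ℂ → ℂ := fun z => f z + -deriv f z with hu
  set v : ℂ → ℂ := fun z => f z + deriv f z with hv
  have hud : Differentiable ℂ u := by fun_prop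
  have hvd : Differentiable ℂ v := by fun_prop
  have huv : ∀ z, u z * v z = Complex.cos (2 * z) := fun z => by rw [← hE]; ring
  have hlim := tendsto_logDeriv_imaginary_axis hud (hft.add (hft.deriv hf).neg)
    (hft.add (hft.deriv hf)) huv
  set α : ℝ → ℂ := fun y => deriv u (y * I) / u (y * I) with hα
  set β : ℝ → ℂ := fun y =>
    -2 * (Complex.sin (2 * (y * I)) / Complex.cos (2 * (y * I))) - α y with hβ
  have hβlim : Tendsto β atTop (𝓝 (-I)) := by
    have := (tendsto_tan_imaginary_axis.const_mul (-2)).sub hlim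
    convert this using 2
    ring
  have hαβ : Tendsto (fun y => α y + β y) atTop (𝓝 (-I + -I)) := hlim.add hβlim
  have hI2 : (-I + -I : ℂ) ≠ 0 := by
    rw [← two_mul]; exact mul_ne_zero two_ne_zero (neg_ne_zero.2 I_ne_zero)
  have h1β : Tendsto (fun y => 1 - β y) atTop (𝓝 (1 - -I)) := hβlim.const_sub 1
  have hquot : Tendsto (fun y => ((2 + α y) * (1 - β y) + (2 - β y) * (1 + α y)) / (α y + β y))
      atTop (𝓝 (3 * I)) := by
    have := (((hlim.const_add 2).mul h1β).add ((hβlim.const_sub 2).mul (hlim.const_add 1))).div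
      hαβ hI2
    convert this using 2
    · rfl
    rw [eq_div_iff hI2]
    ring_nf
    simp only [I_sq]
    ring
  refine hquot.congr' ?_
  filter_upwards [hαβ.eventually_ne hI2, eventually_gt_atTop 0] with y hy1 hy0
  set c : ℂ := y * I with hc
  have hcos : Complex.cos (2 * c) ≠ 0 := cos_two_mul_ne_zero (by simpa [c] using hy0)
  have hu0 : u c ≠ 0 := fun h => hcos (by rw [← huv, h, zero_mul])
  have hu' : deriv u c = deriv f c - deriv (deriv f) c := by
    have := ((hf c).hasDerivAt.add (hf1 c).hasDerivAt.neg).deriv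
    rw [sub_eq_add_neg]; exact this
  have hv' : deriv v c = deriv f c + deriv (deriv f) c :=
    ((hf c).hasDerivAt.add (hf1 c).hasDerivAt).deriv
  have hprod : deriv u c * v c + u c * deriv v c = -2 * Complex.sin (2 * c) := by
    have h1 := (hud c).hasDerivAt.mul (hvd c).hasDerivAt
    have h2 : HasDerivAt (fun z : ℂ => Complex.cos (2 * z)) (-2 * Complex.sin (2 * c)) c := by
      have := ((hasDerivAt_id c).const_mul 2).ccos
      refine this.congr_deriv ?_
      simp; ring
    have h3 : u * v = fun z : ℂ => Complex.cos (2 * z) := funext huv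
    rw [h3] at h1
    exact h1.unique h2
  have hαc : deriv u c = α y * u c := by simp only [hα]; rw [div_mul_cancel₀ _ hu0]
  have hβc : deriv v c = β y * v c := by
    have h1 : u c * deriv v c = u c * (β y * v c) := by
      have h2 : Complex.sin (2 * c) / Complex.cos (2 * c) * (u c * v c) = Complex.sin (2 * c) := by
        rw [huv, div_mul_cancel₀ _ hcos]
      have h3 : β y = -2 * (Complex.sin (2 * c) / Complex.cos (2 * c)) - α y := rfl
      rw [h3]
      linear_combination hprod - v c * hαc + 2 * h2
    exact mul_left_cancel₀ hu0 h1
  have hfc : f c = (u c + v c) / 2 := by simp only [hu, hv]; ring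
  have hf1c : deriv f c = (v c - u c) / 2 := by simp only [hu, hv]; ring
  have hf2c : deriv (deriv f) c = (deriv v c - deriv u c) / 2 := by rw [hu', hv']; ring
  have hrel : (1 + α y) * u c = (1 - β y) * v c := by
    have : deriv u c + deriv v c = v c - u c := by rw [hu', hv']; simp only [hu, hv]; ring
    linear_combination this - hαc - hβc
  rw [hf2c, hαc, hβc, hfc, hf1c]
  have hvu : v c - u c ≠ 0 := fun h => by
    have h1 : v c = u c := sub_eq_zero.1 h
    rw [h1] at hrel
    have h2 := mul_right_cancel₀ hu0 hrel
    exact hy1 (by linear_combination h2)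
  rw [div_eq_div_iff hy1 (div_ne_zero hvu two_ne_zero)]
  linear_combination (-(4 + α y - β y) / 2) * hrel

lemma eq_zero_of_unitType_of_decay {P : ℂ → ℂ} (hd : Differentiable ℂ P) (hP : UnitType P) {C : ℝ}
    (hC : ∀ y : ℝ, ‖P (y * I)‖ ≤ C * Real.exp (-(2 * |y|))) : ∀ z, P z = 0 := by
  obtain ⟨A, hA, hP⟩ := hP
  have hC0 : 0 ≤ C := by simpa using (norm_nonneg _).trans (hC 0)
  set Q : ℂ → ℂ := fun z => P z * P (z * I) with hQ
  have hQd : Differentiable ℂ Q := by fun_prop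
  have hre : ∀ x : ℝ, ‖Q x‖ ≤ A * C * ((1 + |x|) * Real.exp (-|x|)) := fun x => by
    rw [hQ, norm_mul]
    have h1 := hP x
    rw [norm_real, Real.norm_eq_abs] at h1
    calc ‖P x‖ * ‖P (x * I)‖
        ≤ A * ((1 + |x|) * Real.exp |x|) * (C * Real.exp (-(2 * |x|))) :=
          mul_le_mul h1 (hC x) (norm_nonneg _) (by positivity)
      _ = A * C * ((1 + |x|) * (Real.exp |x| * Real.exp (-(2 * |x|)))) := by ring
      _ = _ := by rw [← Real.exp_add]; ring_nf
  have hbd : ∀ x : ℝ, A * C * ((1 + |x|) * Real.exp (-|x|)) ≤ A * C := fun x => by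
    refine mul_le_of_le_one_right (by positivity) ?_
    rw [Real.exp_neg, ← div_eq_mul_inv, div_le_one (Real.exp_pos _), add_comm]
    exact Real.add_one_le_exp _
  have hre' : ∀ x : ℝ, ‖Q x‖ ≤ A * C := fun x => (hre x).trans (hbd x)
  have him' : ∀ x : ℝ, ‖Q (x * I)‖ ≤ A * C := fun x => by
    have h1 := hre' (-x)
    have h2 : (x : ℂ) * I * I = ((-x : ℝ) : ℂ) := by rw [mul_assoc, I_mul_I]; push_cast; ring
    have h3 := hP ((-x : ℝ) : ℂ)
    rw [norm_real, Real.norm_eq_abs, abs_neg] at h3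
    refine le_trans ?_ (hbd x)
    rw [hQ, norm_mul, h2]
    calc ‖P (x * I)‖ * ‖P ((-x : ℝ) : ℂ)‖
        ≤ (C * Real.exp (-(2 * |x|))) * (A * ((1 + |x|) * Real.exp |x|)) :=
          mul_le_mul (hC x) h3 (norm_nonneg _) (by positivity)
      _ = A * C * ((1 + |x|) * (Real.exp |x| * Real.exp (-(2 * |x|)))) := by ring
      _ = _ := by rw [← Real.exp_add]; ring_nf
  have hgrowth : ∀ l : Filter ℂ, ∃ c < (2 : ℝ), ∃ B,
      Q =O[l] fun z => Real.exp (B * ‖z‖ ^ c) := fun l => by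
    refine ⟨1, by norm_num, 4, Asymptotics.IsBigO.of_bound (A * A)
      (Eventually.of_forall fun z => ?_)⟩
    have h1 : ∀ w : ℂ, ‖w‖ = ‖z‖ → ‖P w‖ ≤ A * Real.exp (2 * ‖z‖) := fun w hw => by
      refine (hP w).trans (mul_le_mul_of_nonneg_left ?_ hA.le)
      rw [hw, two_mul, Real.exp_add, add_comm]
      exact mul_le_mul_of_nonneg_right (Real.add_one_le_exp _) (Real.exp_nonneg _)
    rw [Real.rpow_one, Real.norm_of_nonneg (Real.exp_nonneg _), hQ, norm_mul]
    calc ‖P z‖ * ‖P (z * I)‖ ≤ (A * Real.exp (2 * ‖z‖)) * (A * Real.exp (2 * ‖z‖)) :=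
          mul_le_mul (h1 _ rfl) (h1 _ (by simp)) (norm_nonneg _) (by positivity)
      _ = A * A * (Real.exp (2 * ‖z‖) * Real.exp (2 * ‖z‖)) := by ring
      _ = _ := by rw [← Real.exp_add]; ring_nf
  have hall : ∀ z, ‖Q z‖ ≤ A * C := fun z => by
    rcases le_total 0 z.re with h1 | h1 <;> rcases le_total 0 z.im with h2 | h2
    · exact PhragmenLindelof.quadrant_I hQd.diffContOnCl (hgrowth _) (fun x _ => hre' x)
        (fun x _ => him' x) h1 h2
    · exact PhragmenLindelof.quadrant_IV hQd.diffContOnCl (hgrowth _) (fun x _ => hre' x)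
        (fun x _ => him' x) h1 h2
    · exact PhragmenLindelof.quadrant_II hQd.diffContOnCl (hgrowth _) (fun x _ => hre' x)
        (fun x _ => him' x) h1 h2
    · exact PhragmenLindelof.quadrant_III hQd.diffContOnCl (hgrowth _) (fun x _ => hre' x)
        (fun x _ => him' x) h1 h2
  have hbdd : Bornology.IsBounded (Set.range Q) :=
    isBounded_iff_forall_norm_le.2 ⟨A * C, by rintro _ ⟨z, rfl⟩; exact hall z⟩
  have hlim : Tendsto (fun x : ℝ => A * C * ((1 + x) * Real.exp (-x))) atTop (𝓝 0) := by
    have h0 := Real.tendsto_pow_mul_exp_neg_atTop_nhds_zero 0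
    have h1 := Real.tendsto_pow_mul_exp_neg_atTop_nhds_zero 1
    have := (h0.add h1).const_mul (A * C)
    simp only [add_zero, mul_zero] at this
    refine this.congr fun x => ?_
    ring
  have hQ0 : ∀ z, Q z = 0 := fun z => by
    rw [← norm_le_zero_iff]
    refine ge_of_tendsto hlim ((eventually_ge_atTop 0).mono fun x hx => ?_)
    rw [hQd.apply_eq_apply_of_bounded hbdd z x]
    simpa [abs_of_nonneg hx] using hre x
  have hrot : Differentiable ℂ fun z : ℂ => P (z * I) := by fun_prop
  rcases AnalyticOnNhd.eq_zero_or_eq_zero_of_mul_eq_zero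
    (hd.differentiableOn.analyticOnNhd isOpen_univ)
    (hrot.differentiableOn.analyticOnNhd isOpen_univ) (fun z _ => hQ0 z)
    isPreconnected_univ with h | h
  · exact fun z => h z trivial
  · intro z
    have := h (-(z * I)) trivial
    rwa [neg_mul, mul_assoc, I_mul_I, mul_neg_one, neg_neg] at this

lemma deriv_mul_deriv_deriv_sub {f : ℂ → ℂ} (hf : Differentiable ℂ f)
    (hE : ∀ z, f z ^ 2 - deriv f z ^ 2 = Complex.cos (2 * z)) (z : ℂ) :
    deriv f z * (deriv (deriv f) z - f z) = Complex.sin (2 * z) := by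
  have h1 := ((hf z).hasDerivAt.pow 2).sub ((hf.deriv z).hasDerivAt.pow 2)
  have h2 : HasDerivAt (fun z : ℂ => Complex.cos (2 * z)) (-Complex.sin (2 * z) * 2) z := by
    simpa using ((hasDerivAt_id z).const_mul 2).ccos
  have h3 : f ^ 2 - deriv f ^ 2 = fun z : ℂ => Complex.cos (2 * z) := funext hE
  rw [h3] at h1
  have := h1.unique h2
  simp only [Nat.cast_ofNat, Nat.add_one_sub_one, pow_one] at this
  linear_combination -this / 2

lemma deriv_mul_deriv_add_deriv_deriv {f : ℂ → ℂ} (hf : Differentiable ℂ f)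
    (hE : ∀ z, f z ^ 2 - deriv f z ^ 2 = Complex.cos (2 * z)) (z : ℂ) :
    deriv f z * deriv (fun w => f w + deriv (deriv f) w) z
      = (f z + deriv (deriv f) z) * (2 * f z - deriv (deriv f) z) := by
  have d0 := (hf z).hasDerivAt
  have d1 := (hf.deriv z).hasDerivAt
  have d2 := (hf.deriv.deriv z).hasDerivAt
  have h1 := d1.mul (d2.sub d0)
  have h2 : HasDerivAt (fun z : ℂ => Complex.sin (2 * z)) (Complex.cos (2 * z) * 2) z := by
    simpa using ((hasDerivAt_id z).const_mul 2).csin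
  have h3 : deriv f * (deriv (deriv f) - f) = fun z : ℂ => Complex.sin (2 * z) :=
    funext (deriv_mul_deriv_deriv_sub hf hE)
  rw [h3] at h1
  have h4 := h1.unique h2
  have h5 : deriv (fun w => f w + deriv (deriv f) w) z = deriv f z + deriv (deriv (deriv f)) z :=
    (d0.add d2).deriv
  simp only [Pi.sub_apply] at h4
  rw [h5]
  linear_combination h4 - 2 * hE z

lemma exists_decay_bound {f : ℂ → ℂ} (hf : Differentiable ℂ f)
    (hE : ∀ z, f z ^ 2 - deriv f z ^ 2 = Complex.cos (2 * z)) (hft : UnitType f) :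
    ∃ C : ℝ, ∀ y : ℝ, 0 ≤ y →
      ‖f (y * I) + deriv (deriv f) (y * I)‖ ≤ C * Real.exp (-(2 * y)) := by
  set P : ℂ → ℂ := fun w => f w + deriv (deriv f) w with hP
  have hPd : Differentiable ℂ P := hf.add hf.deriv.deriv
  have hratio := tendsto_ratio_imaginary_axis hf hE hft
  set ρ : ℝ → ℂ := fun y => (2 * f (y * I) - deriv (deriv f) (y * I)) / deriv f (y * I) with hρ
  set w : ℝ → ℂ := fun y => Real.exp (2 * y) * P (y * I) with hw
  have hPy : ∀ y : ℝ, HasDerivAt (fun y : ℝ => P (y * I)) (deriv P (y * I) * I) y := fun y => by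
    have h1 : HasDerivAt (fun t : ℝ => (t : ℂ) * I) I y := by
      simpa using (ofRealCLM.hasDerivAt (x := y)).mul_const I
    exact (hPd _).hasDerivAt.comp y h1
  have hwd : ∀ y : ℝ, HasDerivAt w
      (((Real.exp (2 * y) * 2 : ℝ) : ℂ) * P (y * I)
        + Real.exp (2 * y) * (deriv P (y * I) * I)) y := fun y => by
    have h1 : HasDerivAt (fun y : ℝ => Real.exp (2 * y)) (Real.exp (2 * y) * 2) y := by
      simpa using ((hasDerivAt_id y).const_mul 2).exp
    exact h1.ofReal_comp.mul (hPy y)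
  have hκ : Tendsto (fun y => (2 + ρ y * I).re) atTop (𝓝 (-1)) := by
    have := (continuous_re.tendsto _).comp ((hratio.mul_const I).const_add 2)
    convert this using 2
    simp
    norm_num
  obtain ⟨Y, hY⟩ := eventually_atTop.1 ((hκ.eventually_lt_const (show (-1 : ℝ) < 0 by norm_num)).and
    (hratio.eventually_ne (mul_ne_zero three_ne_zero I_ne_zero)))
  have hnsq : ∀ y, HasDerivAt (fun y => ‖w y‖ ^ 2) _ y := fun y => (hwd y).norm_sq
  have hanti : AntitoneOn (fun y => ‖w y‖ ^ 2) (Set.Ici Y) := by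
    refine antitoneOn_of_deriv_nonpos (convex_Ici Y)
      (fun y _ => (hnsq y).continuousAt.continuousWithinAt)
      (fun y _ => (hnsq y).differentiableAt.differentiableWithinAt) (fun y hy => ?_)
    rw [interior_Ici] at hy
    obtain ⟨h1, h2⟩ := hY y (le_of_lt hy)
    have h3 : deriv f (y * I) ≠ 0 := fun h => h2 (by simp only [hρ, h, div_zero])
    have h4 : deriv P (y * I) = P (y * I) * ρ y := by
      have := deriv_mul_deriv_add_deriv_deriv hf hE (y * I)
      simp only [hρ]
      rw [← mul_div_assoc, eq_div_iff h3, mul_comm]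
      exact this
    rw [(hnsq y).deriv, h4]
    have h5 : ((Real.exp (2 * y) * 2 : ℝ) : ℂ) * P (y * I)
        + Real.exp (2 * y) * (P (y * I) * ρ y * I) = w y * (2 + ρ y * I) := by
      simp only [hw]; push_cast; ring
    rw [h5]
    have h6 : inner ℝ (w y) (w y * (2 + ρ y * I)) = ‖w y‖ ^ 2 * (2 + ρ y * I).re := by
      rw [Complex.inner, mul_right_comm, mul_conj, re_ofReal_mul, normSq_eq_norm_sq]
    rw [h6]
    nlinarith [mul_nonneg (sq_nonneg ‖w y‖) (neg_nonneg.2 h1.le)]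
  have hcont : Continuous w := continuous_iff_continuousAt.2 fun y => (hwd y).continuousAt
  obtain ⟨M, hM⟩ := (isCompact_Icc (a := (0 : ℝ)) (b := max Y 0)).exists_bound_of_continuousOn
    hcont.continuousOn
  have hwM : ∀ y, 0 ≤ y → ‖w y‖ ≤ M := fun y hy => by
    rcases le_total y (max Y 0) with h | h
    · exact hM y ⟨hy, h⟩
    · refine le_trans ?_ (hM (max Y 0) ⟨le_max_right _ _, le_rfl⟩)
      exact (sq_le_sq₀ (norm_nonneg _) (norm_nonneg _)).1
        (hanti (le_max_left Y 0) ((le_max_left Y 0).trans h) h)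
  refine ⟨M, fun y hy => ?_⟩
  have := hwM y hy
  rw [hw, norm_mul, norm_real, Real.norm_of_nonneg (Real.exp_nonneg _)] at this
  rw [Real.exp_neg, ← div_eq_mul_inv, le_div_iff₀ (Real.exp_pos _), mul_comm]
  exact this

lemma unitType_of_sq_sub_sq {f : ℂ → ℂ} (hf : Differentiable ℂ f)
    (hE : ∀ z, f z ^ 2 - deriv f z ^ 2 = Complex.cos (2 * z)) : UnitType f := by
  refine unitType_of_norm_deriv_le hf fun z => ?_
  have hcos : ‖Complex.cos (2 * z)‖ ≤ Real.exp ‖z‖ ^ 2 := by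
    have he : ∀ w : ℂ, ‖exp w‖ ≤ Real.exp ‖w‖ := fun w => by
      rw [norm_exp]; exact Real.exp_le_exp.2 (re_le_norm w)
    have h1 := he (2 * z * I)
    have h2 := he (-(2 * z) * I)
    have hn : ‖(2 * z * I : ℂ)‖ = 2 * ‖z‖ := by simp
    have hn' : ‖(-(2 * z) * I : ℂ)‖ = 2 * ‖z‖ := by simp
    rw [hn] at h1
    rw [hn'] at h2
    rw [Complex.cos, norm_div, ← Real.exp_nat_mul]
    simp only [Nat.cast_ofNat, norm_ofNat]
    linarith [norm_add_le (exp (2 * z * I)) (exp (-(2 * z) * I))]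
  have h1 : ‖deriv f z‖ ^ 2 ≤ ‖f z‖ ^ 2 + Real.exp ‖z‖ ^ 2 := by
    rw [← norm_pow, ← norm_pow]
    have : deriv f z ^ 2 = f z ^ 2 - Complex.cos (2 * z) := by rw [← hE]; ring
    rw [this]
    exact (norm_sub_le _ _).trans (by linarith)
  refine le_of_sq_le_sq ?_ (by positivity)
  nlinarith [mul_nonneg (norm_nonneg (f z)) (Real.exp_nonneg ‖z‖)]

lemma self_add_deriv_deriv_eq_zero {f : ℂ → ℂ} (hf : Differentiable ℂ f)
    (hE : ∀ z, f z ^ 2 - deriv f z ^ 2 = Complex.cos (2 * z)) (z : ℂ) :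
    f z + deriv (deriv f) z = 0 := by
  have hft := unitType_of_sq_sub_sq hf hE
  obtain ⟨C, hC⟩ := exists_decay_bound hf hE hft
  have hd1 : deriv (fun z => f (-z)) = fun z => -deriv f (-z) := funext fun z => deriv_comp_neg f z
  have hd2 : deriv (deriv fun z => f (-z)) = fun z => deriv (deriv f) (-z) := by
    rw [hd1]
    funext z
    rw [deriv.fun_neg, deriv_comp_neg, neg_neg]
  have hfn : Differentiable ℂ fun z => f (-z) := by fun_prop
  have hEn : ∀ z, f (-z) ^ 2 - deriv (fun z => f (-z)) z ^ 2 = Complex.cos (2 * z) := fun z => by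
    rw [hd1, neg_sq, hE, mul_neg, Complex.cos_neg]
  obtain ⟨D, hD⟩ := exists_decay_bound hfn hEn (unitType_of_sq_sub_sq hfn hEn)
  simp only [hd2] at hD
  refine eq_zero_of_unitType_of_decay (P := fun z => f z + deriv (deriv f) z)
    (hf.add hf.deriv.deriv) (hft.add ((hft.deriv hf).deriv hf.deriv)) (C := max C D) (fun y => ?_) z
  rcases le_total 0 y with hy | hy
  · rw [abs_of_nonneg hy]
    exact (hC y hy).trans (mul_le_mul_of_nonneg_right (le_max_left _ _) (Real.exp_nonneg _))
  · rw [abs_of_nonpos hy]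
    have := hD (-y) (by linarith)
    push_cast at this
    rw [neg_mul, neg_neg] at this
    exact this.trans (mul_le_mul_of_nonneg_right (le_max_right _ _) (Real.exp_nonneg _))

lemma eq_cos_add_sin {f : ℂ → ℂ} (hf : Differentiable ℂ f)
    (h : ∀ z, f z + deriv (deriv f) z = 0) (z : ℂ) :
    f z = f 0 * Complex.cos z + deriv f 0 * Complex.sin z := by
  have d0 := fun z => (hf z).hasDerivAt
  have d1 := fun z => (hf.deriv z).hasDerivAt
  have hA : ∀ z, HasDerivAt (fun z => f z * Complex.cos z - deriv f z * Complex.sin z) 0 z :=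
    fun z => by
      refine (((d0 z).mul (hasDerivAt_cos z)).sub ((d1 z).mul (hasDerivAt_sin z))).congr_deriv ?_
      linear_combination -Complex.sin z * h z
  have hB : ∀ z, HasDerivAt (fun z => f z * Complex.sin z + deriv f z * Complex.cos z) 0 z :=
    fun z => by
      refine (((d0 z).mul (hasDerivAt_sin z)).add ((d1 z).mul (hasDerivAt_cos z))).congr_deriv ?_
      linear_combination Complex.cos z * h z
  have hA' := is_const_of_deriv_eq_zero (fun z => (hA z).differentiableAt)
    (fun z => (hA z).deriv) z 0
  have hB' := is_const_of_deriv_eq_zero (fun z => (hB z).differentiableAt)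
    (fun z => (hB z).deriv) z 0
  simp only [Complex.cos_zero, Complex.sin_zero, mul_one, mul_zero, sub_zero, zero_add] at hA' hB'
  linear_combination Complex.cos z * hA' + Complex.sin z * hB' - f z * Complex.sin_sq_add_cos_sq z

theorem stmt_8 (f : ℂ → ℂ) (hf : Differentiable ℂ f) :
    (∀ z : ℂ, f z ^ 2 - (deriv f z) ^ 2
        = (1 / 2) * Complex.exp (2 * Complex.I * z)
          + (1 / 2) * Complex.exp (-(2 * Complex.I) * z)) ↔
    ((∀ z : ℂ, f z = Complex.cos z) ∨ (∀ z : ℂ, f z = -Complex.cos z) ∨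
     (∀ z : ℂ, f z = Complex.I * Complex.sin z) ∨
     (∀ z : ℂ, f z = -(Complex.I * Complex.sin z))) := by
  have hcos : ∀ z : ℂ, (1 / 2) * Complex.exp (2 * Complex.I * z)
      + (1 / 2) * Complex.exp (-(2 * Complex.I) * z) = Complex.cos (2 * z) := fun z => by
    rw [Complex.cos, show 2 * z * I = 2 * I * z by ring, show -(2 * z) * I = -(2 * I) * z by ring]
    ring
  simp only [hcos]
  constructor
  · intro hE
    have hsol := eq_cos_add_sin hf (self_add_deriv_deriv_eq_zero hf hE)
    have h0 : f 0 ^ 2 - deriv f 0 ^ 2 = 1 := by simpa using hE 0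
    have h1 : deriv f 0 * (deriv (deriv f) 0 - f 0) = 0 := by
      simpa using deriv_mul_deriv_deriv_sub hf hE 0
    have h2 : deriv f 0 * f 0 = 0 := by
      linear_combination -h1 / 2 + deriv f 0 / 2 * self_add_deriv_deriv_eq_zero hf hE 0
    rcases mul_eq_zero.1 h2 with h | h
    · have h3 : f 0 ^ 2 = 1 := by rw [← h0, h]; ring
      rcases sq_eq_sq_iff_eq_or_eq_neg.1 (h3.trans (one_pow 2).symm) with h4 | h4
      · exact Or.inl fun z => by rw [hsol, h, h4]; ring
      · exact Or.inr (Or.inl fun z => by rw [hsol, h, h4]; ring)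
    · have h3 : deriv f 0 ^ 2 = I ^ 2 := by rw [I_sq, ← h0, h]; ring
      rcases sq_eq_sq_iff_eq_or_eq_neg.1 h3 with h4 | h4
      · exact Or.inr (Or.inr (Or.inl fun z => by rw [hsol, h, h4]; ring))
      · exact Or.inr (Or.inr (Or.inr fun z => by rw [hsol, h, h4]; ring))
  · have hsq : ∀ z : ℂ, Complex.cos (2 * z) = Complex.cos z ^ 2 - Complex.sin z ^ 2 :=
      Complex.cos_two_mul'
    rintro (h | h | h | h) z <;> rw [hsq, funext h]
    · rw [Complex.deriv_cos]; ring
    · rw [((hasDerivAt_cos z).fun_neg).deriv]; ring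
    · rw [((hasDerivAt_sin z).const_mul I).deriv]
      linear_combination (Complex.sin z ^ 2 - Complex.cos z ^ 2) * I_sq
    · rw [(((hasDerivAt_sin z).const_mul I).fun_neg).deriv]
      linear_combination (Complex.sin z ^ 2 - Complex.cos z ^ 2) * I_sq
end

section
/- Let n be an integer with 2 ≤ n ≤ 4 and let a, p₁, p₂, b be nonzero complex constants. If f is an entire function satisfying f(z)ⁿ + a·(f'(z))ⁿ = p₁·e^{bz} + p₂·e^{−bz} for all z ∈ ℂ, then the set {z ∈ ℂ : f(z) = 0} is infinite. -/
open Complex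

/-- An entire function with finitely many zeros is a polynomial times a zero-free function. -/
theorem exists_eq_polynomial_mul_of_zeros_subset (s : Finset ℂ) :
    ∀ f : ℂ → ℂ, Differentiable ℂ f → (∃ z, f z ≠ 0) → (∀ z, f z = 0 → z ∈ s) →
      ∃ (P : Polynomial ℂ) (F : ℂ → ℂ), Differentiable ℂ F ∧ (∀ z, F z ≠ 0) ∧
        ∀ z, f z = P.eval z * F z := by
  induction s using Finset.induction_on with
  | empty =>
    intro f hf _ hs
    exact ⟨1, f, hf, fun z hz => by simpa using hs z hz, by simp⟩
  | insert c s _ ih =>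
    intro f hf hne hs
    obtain ⟨p, hp⟩ := hf.analyticAt c
    have hp0 : p ≠ 0 := by
      intro h
      obtain ⟨z, hz⟩ := hne
      have h0 := (hp.locally_zero_iff).2 h
      have hA : AnalyticOnNhd ℂ f Set.univ := fun z _ => hf.analyticAt z
      exact hz (congrFun (hA.eq_of_eventuallyEq (g := 0) (fun _ _ => analyticAt_const) h0) z)
    have hd : ∀ m : ℕ, Differentiable ℂ ((Function.swap dslope c)^[m] f) := by
      intro m
      induction m with
      | zero => exact hf
      | succ m ihm =>
        rw [Function.iterate_succ_apply', ← differentiableOn_univ]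
        exact (differentiableOn_dslope Filter.univ_mem).2 ihm.differentiableOn
    have hfac := hp.eq_pow_order_mul_iterate_dslope
    have hc := hp.iterate_dslope_fslope_ne_zero hp0
    obtain ⟨P, F, hF, hF0, hPF⟩ := ih _ (hd p.order) ⟨c, hc⟩ (by
      intro z hz
      have := hs z (by rw [hfac, hz, smul_zero])
      rcases Finset.mem_insert.1 this with rfl | h
      · exact absurd hz hc
      · exact h)
    refine ⟨(Polynomial.X - Polynomial.C c) ^ p.order * P, F, hF, hF0, fun z => ?_⟩
    rw [hfac, hPF]
    simp [mul_assoc]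

/-- A zero-free entire function has an entire logarithm. -/
theorem exists_eq_exp_of_ne_zero {F : ℂ → ℂ} (hF : Differentiable ℂ F) (h0 : ∀ z, F z ≠ 0) :
    ∃ g : ℂ → ℂ, Differentiable ℂ g ∧ ∀ z, F z = exp (g z) := by
  have hq : Differentiable ℂ fun z => deriv F z / F z := hF.deriv.div hF h0
  obtain ⟨g, hg0, hg⟩ := hq.isExactOn_univ.with_val_at 0 (log (F 0))
  have hg' : ∀ z, HasDerivAt g (deriv F z / F z) z := fun z => hg z (Set.mem_univ z)
  refine ⟨g, fun z => (hg' z).differentiableAt, fun z => ?_⟩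
  have hder : ∀ z, HasDerivAt (fun z => F z * exp (-g z)) 0 z := by
    intro z
    refine ((hF z).hasDerivAt.mul (hg' z).neg.cexp).congr_deriv ?_
    field_simp [h0 z]
    simp
  have hconst := is_const_of_deriv_eq_zero (fun z => (hder z).differentiableAt)
    (fun z => (hder z).deriv) z 0
  have h1 : F z * exp (-g z) = 1 := by
    rw [hconst, hg0, exp_neg, exp_log (h0 0), mul_inv_cancel₀ (h0 0)]
  rw [exp_neg] at h1
  exact (eq_of_mul_inv_eq_one h1)

/-- A nonzero polynomial is never an eigenvector of the second derivative with a nonzero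
eigenvalue. -/
theorem Polynomial.eq_zero_of_derivative_derivative_eq {b : ℂ} (hb : b ≠ 0) {R : Polynomial ℂ}
    (h : R.derivative.derivative = Polynomial.C b * R) : R = 0 := by
  by_contra hR
  have h1 : R.derivative.derivative.degree = R.degree := by
    rw [h, Polynomial.degree_C_mul hb]
  have h2 := Polynomial.degree_derivative_lt hR
  exact absurd h1 ((Polynomial.degree_derivative_le.trans_lt h2).ne)

theorem exp_sum_hasDerivAt (p₁ p₂ b z : ℂ) :
    HasDerivAt (fun z => p₁ * exp (b * z) + p₂ * exp (-b * z))
      (p₁ * b * exp (b * z) + -(p₂ * b) * exp (-b * z)) z := by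
  have h (c : ℂ) : HasDerivAt (fun z => exp (c * z)) (exp (c * z) * (c * 1)) z :=
    ((hasDerivAt_id z).const_mul c).cexp
  exact (((h b).const_mul p₁).add ((h (-b)).const_mul p₂)).congr_deriv (by ring)

theorem exp_sum_exists_ne_zero {p₁ p₂ b : ℂ} (hp₁ : p₁ ≠ 0) (hb : b ≠ 0) :
    ∃ z, p₁ * exp (b * z) + p₂ * exp (-b * z) ≠ 0 := by
  by_contra! h
  have h0 := h 0
  have hd : p₁ * b * exp (b * 0) + -(p₂ * b) * exp (-b * 0) = 0 := by
    rw [← (exp_sum_hasDerivAt p₁ p₂ b 0).deriv, funext h, deriv_const]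
  simp only [mul_zero, exp_zero, mul_one] at h0 hd
  have : 2 * p₁ * b = 0 := by linear_combination b * h0 + hd
  simp [hp₁, hb] at this

theorem exp_sum_ne_polynomial {p₁ p₂ b : ℂ} (hp₁ : p₁ ≠ 0) (hb : b ≠ 0) (R : Polynomial ℂ) :
    ¬ ∀ z, R.eval z = p₁ * exp (b * z) + p₂ * exp (-b * z) := by
  intro h
  have h1 : ∀ z, R.derivative.eval z = p₁ * b * exp (b * z) + -(p₂ * b) * exp (-b * z) := by
    intro z
    rw [← R.deriv, funext h, (exp_sum_hasDerivAt p₁ p₂ b z).deriv]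
  have h2 : R.derivative.derivative = Polynomial.C (b ^ 2) * R := by
    refine Polynomial.funext fun z => ?_
    rw [← Polynomial.deriv, funext h1, (exp_sum_hasDerivAt _ _ b z).deriv, Polynomial.eval_mul,
      Polynomial.eval_C, h]
    ring
  have h3 := Polynomial.eq_zero_of_derivative_derivative_eq (pow_ne_zero 2 hb) h2
  obtain ⟨z, hz⟩ := exp_sum_exists_ne_zero (p₂ := p₂) hp₁ hb
  exact hz (by rw [← h z, h3, Polynomial.eval_zero])

theorem derivative_bound_of_re_le {G : ℂ → ℂ} (hG : Differentiable ℂ G) {z₀ : ℂ} {ρ d x : ℝ}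
    (hd : d = ρ - ‖z₀‖) (hd0 : 0 < d) (hρ : 1 ≤ ρ) (hx : 1 ≤ x) (hxd : 1 ≤ x * d)
    (hre : ∀ z, ‖z‖ ≤ ρ - d / 2 → (G z).re ≤ 2 * x) :
    1 + ‖z₀‖ + ‖deriv G z₀‖ + ‖deriv (deriv G) z₀‖ ≤ (600 + 300 * ‖G 0‖) * (ρ * x ^ 4) := by
  set M := ‖G 0‖
  have hM : 0 ≤ M := norm_nonneg _
  have hz₀ : 0 ≤ ‖z₀‖ := norm_nonneg _
  have hdi : 1 / d ≤ x := by rwa [div_le_iff₀ hd0]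
  have hdi0 : 0 < 1 / d := by positivity
  set B := (16 + 8 * M) * (ρ * x ^ 2) with hB
  have hB0 : 0 ≤ B := by positivity
  have hbound : ∀ z, ‖z‖ ≤ ρ - 3 * d / 4 → ‖G z‖ ≤ B := by
    intro z hz
    have hz0 : 0 ≤ ‖z‖ := norm_nonneg _
    have hbc := borelCaratheodory (M := 2 * x) (R := ρ - d / 2) (f := G) (z := z) (by linarith)
      hG.differentiableOn (fun w hw => hre w (mem_ball_zero_iff.1 hw).le) (by linarith)
      (mem_ball_zero_iff.2 (by linarith))
    have hden : d / 4 ≤ ρ - d / 2 - ‖z‖ := by linarith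
    calc ‖G z‖ ≤ _ := hbc
      _ ≤ 2 * (2 * x) * ρ / (d / 4) + M * (2 * ρ) / (d / 4) := by
        gcongr
        · linarith
        · linarith
      _ = (16 * (ρ * x) + 8 * M * ρ) * (1 / d) := by field_simp; ring
      _ ≤ (16 * (ρ * x) + 8 * M * (ρ * x)) * x := by
        gcongr
        nlinarith
      _ = B := by rw [hB]; ring
  have hsph : ∀ z ∈ Metric.sphere z₀ (d / 4), ‖G z‖ ≤ B := by
    intro z hz
    apply hbound
    have h1 : ‖z - z₀‖ = d / 4 := by rwa [mem_sphere_iff_norm] at hz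
    have h2 := norm_sub_norm_le z z₀
    linarith
  have h1 : ‖deriv G z₀‖ ≤ 4 * B * x := by
    calc _ ≤ B / (d / 4) :=
          norm_deriv_le_of_forall_mem_sphere_norm_le (by positivity) hG.diffContOnCl hsph
      _ = 4 * B * (1 / d) := by field_simp
      _ ≤ _ := by gcongr
  have h2 : ‖deriv (deriv G) z₀‖ ≤ 32 * B * x ^ 2 := by
    have := norm_iteratedDeriv_le_of_forall_mem_sphere_norm_le 2 (by positivity)
      hG.diffContOnCl hsph
    rw [iteratedDeriv_succ, iteratedDeriv_one] at this
    calc _ ≤ _ := this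
      _ = 32 * B * (1 / d) ^ 2 := by
        simp only [Nat.factorial]; push_cast; field_simp; ring
      _ ≤ _ := by gcongr
  have hx2 : x ≤ x ^ 2 := le_self_pow₀ hx (by norm_num)
  have hx4 : 1 ≤ x ^ 4 := one_le_pow₀ hx
  have hρx : ρ ≤ ρ * x ^ 4 := le_mul_of_one_le_right (by linarith) hx4
  have h3 : B * x ≤ B * x ^ 2 := by gcongr
  have h4 : B * x ^ 2 = (16 + 8 * M) * (ρ * x ^ 4) := by rw [hB]; ring
  have h5 : 0 ≤ M * (ρ * x ^ 4) := by positivity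
  have hz1 : ‖z₀‖ ≤ ρ := by linarith
  nlinarith

/-- If `exp (Re G)` is bounded polynomially in `z`, `G'` and `G''`, then `Re G` grows at most like
the square root of `‖z‖`. -/
theorem re_le_of_exp_re_le {G : ℂ → ℂ} (hG : Differentiable ℂ G) {C : ℝ} {k : ℕ} (hk : k ≠ 0)
    (h : ∀ z, Real.exp (G z).re ≤ C * (1 + ‖z‖ + ‖deriv G z‖ + ‖deriv (deriv G) z‖) ^ k) :
    ∃ E : ℝ, 0 ≤ E ∧ ∀ t : ℝ, 1 ≤ t → ∀ z, ‖z‖ ≤ t ^ 2 / 2 → (G z).re ≤ 2 * (E * t) := by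
  have hC : 0 < C := by
    by_contra! hC
    have := (Real.exp_pos _).trans_le (h 0)
    exact absurd this (not_lt.2 (mul_nonpos_of_nonpos_of_nonneg hC (by positivity)))
  set L := 600 + 300 * ‖G 0‖
  set A := C * L ^ k * (6 * k).factorial with hA
  refine ⟨max A 1, by positivity, fun t ht z hz => ?_⟩
  set E := max A 1
  have hE1 : 1 ≤ E := le_max_right _ _
  set ρ := t ^ 2 with hρt
  have hρ : 1 ≤ ρ := one_le_pow₀ ht
  obtain ⟨z₀, hz₀, hmax⟩ := (isCompact_closedBall (0 : ℂ) ρ).exists_isMaxOn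
    ⟨0, by simp; linarith⟩ (f := fun z => (G z).re * (ρ - ‖z‖))
    (by have := hG.continuous; fun_prop)
  replace hmax : ∀ w, ‖w‖ ≤ ρ → (G w).re * (ρ - ‖w‖) ≤ (G z₀).re * (ρ - ‖z₀‖) :=
    fun w hw => hmax (mem_closedBall_zero_iff.2 hw)
  rw [mem_closedBall_zero_iff] at hz₀
  have hEt : 1 ≤ E * t := by nlinarith
  suffices hS : (G z₀).re * (ρ - ‖z₀‖) ≤ ρ * (E * t) by
    have h1 := (hmax z (by linarith)).trans hS
    by_contra! h2
    have : ρ / 2 * (2 * (E * t)) < (ρ - ‖z‖) * (G z).re :=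
      mul_lt_mul' (by linarith) h2 (by positivity) (by linarith)
    linarith
  set x := (G z₀).re
  set d := ρ - ‖z₀‖ with hd
  by_cases hSρ : x * d ≤ ρ
  · exact hSρ.trans (le_mul_of_one_le_right (by linarith) hEt)
  push Not at hSρ
  have hd0 : 0 < d := by
    rcases (sub_nonneg.2 hz₀).eq_or_lt with h0 | h0
    · rw [hd, ← h0, mul_zero] at hSρ; linarith
    · exact h0
  have hdρ : d ≤ ρ := by linarith [norm_nonneg z₀]
  have hx : 1 ≤ x := by
    by_contra! hx
    nlinarith
  have hx0 : 0 < x := by linarith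
  have hre : ∀ w, ‖w‖ ≤ ρ - d / 2 → (G w).re ≤ 2 * x := by
    intro w hw
    have h1 := hmax w (by linarith)
    by_contra! h2
    have : d / 2 * (2 * x) < (ρ - ‖w‖) * (G w).re :=
      mul_lt_mul' (by linarith) h2 (by linarith) (by linarith)
    linarith
  have hder := derivative_bound_of_re_le hG hd hd0 hρ hx (by linarith) hre
  have hexp : x ^ (6 * k) / (6 * k).factorial ≤ C * (L * (ρ * x ^ 4)) ^ k :=
    (Real.pow_div_factorial_le_exp _ hx0.le _).trans <| (h z₀).trans (by gcongr)
  have h6 : x ^ (2 * k) ≤ A * t ^ (2 * k) := by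
    rw [div_le_iff₀ (by positivity)] at hexp
    refine le_of_mul_le_mul_right ?_ (pow_pos hx0 (4 * k))
    calc x ^ (2 * k) * x ^ (4 * k) = x ^ (6 * k) := by rw [← pow_add]; congr 1; ring
      _ ≤ _ := hexp
      _ = _ := by rw [hA, hρt]; simp only [mul_pow, pow_mul]; ring
  have h7 : x ≤ E * t := by
    rw [← pow_le_pow_iff_left₀ hx0.le (by positivity) (show 2 * k ≠ 0 by positivity), mul_pow]
    refine h6.trans ?_
    gcongr
    exact (le_max_left A 1).trans (le_self_pow₀ hE1 (by positivity))
  calc x * d ≤ (E * t) * ρ := by gcongr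
    _ = _ := by ring

theorem deriv_eq_zero_of_exp_re_le {G : ℂ → ℂ} (hG : Differentiable ℂ G) {C : ℝ} {k : ℕ}
    (hk : k ≠ 0)
    (h : ∀ z, Real.exp (G z).re ≤ C * (1 + ‖z‖ + ‖deriv G z‖ + ‖deriv (deriv G) z‖) ^ k) (c : ℂ) :
    deriv G c = 0 := by
  obtain ⟨E, hE, hre⟩ := re_le_of_exp_re_le hG hk h
  set M := ‖G 0‖
  set K := 8 * (4 * (E + 1) + 3 * M)
  have hK : ∀ t : ℝ, 1 ≤ t → 8 * ‖c‖ ≤ t → ‖deriv G c‖ * t ≤ K := by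
    intro t ht hct
    have ht2 : t ≤ t ^ 2 := le_self_pow₀ ht (by norm_num)
    have hsph : ∀ z ∈ Metric.sphere c (t ^ 2 / 8), ‖G z‖ ≤ 4 * (E + 1) * t + 3 * M := by
      intro z hz
      have h1 : ‖z - c‖ = t ^ 2 / 8 := by rwa [mem_sphere_iff_norm] at hz
      have h2 := norm_sub_norm_le z c
      have hz4 : ‖z‖ ≤ t ^ 2 / 4 := by linarith
      have hbc := borelCaratheodory (M := 2 * ((E + 1) * t)) (R := t ^ 2 / 2) (f := G) (z := z)
        (by positivity) hG.differentiableOn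
        (fun w hw => (hre t ht w (mem_ball_zero_iff.1 hw).le).trans (by gcongr; linarith))
        (by positivity) (mem_ball_zero_iff.2 (by linarith))
      calc ‖G z‖ ≤ _ := hbc
        _ ≤ 2 * (2 * ((E + 1) * t)) * (t ^ 2 / 4) / (t ^ 2 / 4)
            + M * (t ^ 2 / 2 + t ^ 2 / 4) / (t ^ 2 / 4) := by
          gcongr <;> linarith
        _ = _ := by field_simp; ring
    have h3 := norm_deriv_le_of_forall_mem_sphere_norm_le (by positivity) hG.diffContOnCl hsph
    rw [le_div_iff₀ (by positivity)] at h3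
    have hM : 0 ≤ M := norm_nonneg _
    have h4 : ‖deriv G c‖ * t * t ≤ K * t := by
      calc _ = 8 * (‖deriv G c‖ * (t ^ 2 / 8)) := by ring
        _ ≤ 8 * (4 * (E + 1) * t + 3 * M) := by gcongr
        _ ≤ 8 * (4 * (E + 1) * t + 3 * M * t) := by
          linarith [le_mul_of_one_le_right hM ht]
        _ = _ := by ring
    exact le_of_mul_le_mul_right h4 (by linarith)
  by_contra hne
  have hpos : 0 < ‖deriv G c‖ := norm_pos_iff.2 hne
  have hK0 : 0 ≤ K := by positivity
  have hq : 0 ≤ K / ‖deriv G c‖ := by positivity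
  have := hK (K / ‖deriv G c‖ + 1 + 8 * ‖c‖) (by linarith [norm_nonneg c]) (by linarith)
  have h5 : ‖deriv G c‖ * (K / ‖deriv G c‖) = K := by field_simp
  have h6 := mul_nonneg hpos.le (norm_nonneg c)
  nlinarith

/-- The functions bounded by a constant times a power of the weight `Λ ≥ 1`. -/
def powerBounded (Λ : ℂ → ℝ) (hΛ : ∀ z, 1 ≤ Λ z) : Subalgebra ℂ (ℂ → ℂ) where
  carrier := {F | ∃ C : ℝ, 0 ≤ C ∧ ∃ k : ℕ, ∀ z, ‖F z‖ ≤ C * Λ z ^ k}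
  mul_mem' := by
    rintro F₁ F₂ ⟨C₁, hC₁, k₁, h₁⟩ ⟨C₂, hC₂, k₂, h₂⟩
    refine ⟨C₁ * C₂, by positivity, k₁ + k₂, fun z => ?_⟩
    calc ‖F₁ z * F₂ z‖ = ‖F₁ z‖ * ‖F₂ z‖ := norm_mul _ _
      _ ≤ (C₁ * Λ z ^ k₁) * (C₂ * Λ z ^ k₂) :=
        mul_le_mul (h₁ z) (h₂ z) (norm_nonneg _) ((norm_nonneg _).trans (h₁ z))
      _ = _ := by ring
  add_mem' := by
    rintro F₁ F₂ ⟨C₁, hC₁, k₁, h₁⟩ ⟨C₂, hC₂, k₂, h₂⟩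
    refine ⟨C₁ + C₂, by positivity, k₁ + k₂, fun z => ?_⟩
    have hz := hΛ z
    calc ‖F₁ z + F₂ z‖ ≤ ‖F₁ z‖ + ‖F₂ z‖ := norm_add_le _ _
      _ ≤ C₁ * Λ z ^ k₁ + C₂ * Λ z ^ k₂ := add_le_add (h₁ z) (h₂ z)
      _ ≤ C₁ * Λ z ^ (k₁ + k₂) + C₂ * Λ z ^ (k₁ + k₂) := by
        gcongr <;> first | exact hz | omega
      _ = _ := by ring
  algebraMap_mem' c := ⟨‖c‖, norm_nonneg c, 0, fun z => by simp⟩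

theorem polynomial_eval_mem {S : Subalgebra ℂ (ℂ → ℂ)} (hS : (fun z => z) ∈ S)
    (P : Polynomial ℂ) : (fun z => P.eval z) ∈ S := by
  induction P using Polynomial.induction_on' with
  | add P Q hP hQ =>
    simp only [Polynomial.eval_add]
    exact S.add_mem hP hQ
  | monomial k c =>
    simp only [Polynomial.eval_monomial]
    exact S.mul_mem (S.algebraMap_mem c) (S.pow_mem hS k)

/-- Eliminating `q = p₁ e^{bz} + p₂ e^{-bz}` from `W = e^{nG} q` by the first integral
`q'² - b² q² = -4 b² p₁ p₂`. -/
theorem first_integral_of_eq_exp_mul {G W : ℂ → ℂ} {W' p₁ p₂ b z : ℂ} {n : ℕ}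
    (hG : Differentiable ℂ G)
    (hW : ∀ z, W z = exp (n * G z) * (p₁ * exp (b * z) + p₂ * exp (-b * z)))
    (hW' : HasDerivAt W W' z) :
    (W' - n * deriv G z * W z) ^ 2 - b ^ 2 * W z ^ 2 =
      -4 * b ^ 2 * p₁ * p₂ * exp (n * G z) ^ 2 := by
  have h1 := (((hG z).hasDerivAt.const_mul (n : ℂ)).cexp).mul (exp_sum_hasDerivAt p₁ p₂ b z)
  have h2 := hW'.unique (h1.congr_of_eventuallyEq (.of_forall hW))
  have h3 : exp (b * z) * exp (-b * z) = 1 := by rw [← exp_add]; simp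
  rw [h2, hW]
  linear_combination (-4 * b ^ 2 * p₁ * p₂ * exp (n * G z) ^ 2) * h3

theorem deriv_eq_zero_of_polynomial_mul_exp {n : ℕ} (hn : n ≠ 0) {a p₁ p₂ b : ℂ} (hp₁ : p₁ ≠ 0)
    (hp₂ : p₂ ≠ 0) (hb : b ≠ 0) {f G : ℂ → ℂ} {P : Polynomial ℂ} (hG : Differentiable ℂ G)
    (hf : ∀ z, f z = P.eval z * exp (-G z))
    (heq : ∀ z, f z ^ n + a * (deriv f z) ^ n = p₁ * exp (b * z) + p₂ * exp (-b * z)) (c : ℂ) :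
    deriv G c = 0 := by
  have hG' : ∀ z, HasDerivAt G (deriv G z) z := fun z => (hG z).hasDerivAt
  have hG'' : ∀ z, HasDerivAt (deriv G) (deriv (deriv G) z) z :=
    fun z => (hG.deriv z).hasDerivAt
  set H : ℂ → ℂ := fun z => P.derivative.eval z - P.eval z * deriv G z with hH
  set H' : ℂ → ℂ := fun z => P.derivative.derivative.eval z -
    (P.derivative.eval z * deriv G z + P.eval z * deriv (deriv G) z)
  set W : ℂ → ℂ := fun z => P.eval z ^ n + a * H z ^ n with hWdef
  set W' : ℂ → ℂ := fun z => n * P.eval z ^ (n - 1) * P.derivative.eval z +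
    a * (n * H z ^ (n - 1) * H' z)
  have hHd : ∀ z, HasDerivAt H (H' z) z := fun z =>
    (P.derivative.hasDerivAt z).sub ((P.hasDerivAt z).mul (hG'' z))
  have hWd : ∀ z, HasDerivAt W (W' z) z := fun z =>
    ((P.hasDerivAt z).pow n).add (((hHd z).pow n).const_mul a)
  have hfd : ∀ z, deriv f z = H z * exp (-G z) := by
    intro z
    rw [funext hf]
    refine (((P.hasDerivAt z).mul (hG' z).neg.cexp).congr_deriv ?_).deriv
    simp only [hH, Pi.neg_apply]; ring
  have hW : ∀ z, W z = exp (n * G z) * (p₁ * exp (b * z) + p₂ * exp (-b * z)) := by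
    intro z
    rw [← heq, hf, hfd, mul_pow, mul_pow, ← exp_nat_mul, mul_neg, exp_neg]
    have := exp_ne_zero (n * G z)
    simp only [hWdef]
    field_simp
  set Λ : ℂ → ℝ := fun z => 1 + ‖z‖ + ‖deriv G z‖ + ‖deriv (deriv G) z‖ with hΛdef
  have hΛ : ∀ z, 1 ≤ Λ z := fun z => by
    have := norm_nonneg z
    have := norm_nonneg (deriv G z)
    have := norm_nonneg (deriv (deriv G) z)
    simp only [hΛdef]; linarith
  set S := powerBounded Λ hΛ
  have mem_of_le : ∀ F : ℂ → ℂ, (∀ z, ‖F z‖ ≤ Λ z) → F ∈ S :=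
    fun F hF => ⟨1, zero_le_one, 1, fun z => by simpa using hF z⟩
  have hidS : (fun z => z) ∈ S := mem_of_le _ fun z => by
    have := norm_nonneg (deriv G z)
    have := norm_nonneg (deriv (deriv G) z)
    simp only [hΛdef]; linarith
  have hGS : deriv G ∈ S := mem_of_le _ fun z => by
    have := norm_nonneg z
    have := norm_nonneg (deriv (deriv G) z)
    simp only [hΛdef]; linarith
  have hGS' : deriv (deriv G) ∈ S := mem_of_le _ fun z => by
    have := norm_nonneg z
    have := norm_nonneg (deriv G z)
    simp only [hΛdef]; linarith
  have hcS : ∀ c : ℂ, (fun _ : ℂ => c) ∈ S := S.algebraMap_mem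
  have hPS := polynomial_eval_mem hidS
  have hHS : H ∈ S := S.sub_mem (hPS _) (S.mul_mem (hPS P) hGS)
  have hHS' : H' ∈ S :=
    S.sub_mem (hPS _) (S.add_mem (S.mul_mem (hPS _) hGS) (S.mul_mem (hPS P) hGS'))
  have hWS : W ∈ S := S.add_mem (S.pow_mem (hPS P) n) (S.mul_mem (hcS a) (S.pow_mem hHS n))
  have hWS' : W' ∈ S :=
    S.add_mem (S.mul_mem (S.mul_mem (hcS n) (S.pow_mem (hPS P) _)) (hPS _))
      (S.mul_mem (hcS a) (S.mul_mem (S.mul_mem (hcS n) (S.pow_mem hHS _)) hHS'))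
  have hES : (fun z => exp (n * G z) ^ 2) ∈ S := by
    have h1 : (fun z => (-4 * b ^ 2 * p₁ * p₂)⁻¹ *
        ((W' z - n * deriv G z * W z) ^ 2 - b ^ 2 * W z ^ 2)) ∈ S :=
      S.mul_mem (hcS _) (S.sub_mem
        (S.pow_mem (S.sub_mem hWS' (S.mul_mem (S.mul_mem (hcS n) hGS) hWS)) 2)
        (S.mul_mem (hcS _) (S.pow_mem hWS 2)))
    convert h1 using 2 with z
    rw [first_integral_of_eq_exp_mul hG hW (hWd z)]
    field_simp
  obtain ⟨C, hC, k, hCk⟩ := hES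
  refine deriv_eq_zero_of_exp_re_le hG (C := 1 + C) (k := k + 1) k.succ_ne_zero (fun z => ?_) c
  change _ ≤ (1 + C) * Λ z ^ (k + 1)
  have hz := hCk z
  have hk1 : 1 ≤ Λ z ^ (k + 1) := one_le_pow₀ (hΛ z)
  have hkk : Λ z ^ k ≤ Λ z ^ (k + 1) := pow_le_pow_right₀ (hΛ z) k.le_succ
  have hC' : C * Λ z ^ k ≤ C * Λ z ^ (k + 1) := by gcongr
  have hCpos : 0 ≤ C * Λ z ^ (k + 1) := by positivity
  have hre : ‖exp (n * G z) ^ 2‖ = Real.exp (2 * n * (G z).re) := by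
    rw [← exp_nat_mul, norm_exp]
    congr 1
    simp [mul_assoc]
  rw [hre] at hz
  rcases le_total (G z).re 0 with h0 | h0
  · have := Real.exp_le_one_iff.2 h0
    linarith
  · have hn1 : (1 : ℝ) ≤ n := by exact_mod_cast Nat.one_le_iff_ne_zero.2 hn
    have : Real.exp (G z).re ≤ Real.exp (2 * n * (G z).re) := by
      gcongr; nlinarith
    linarith

theorem stmt_11 (n : ℕ) (hn2 : 2 ≤ n) (hn4 : n ≤ 4)
    (a p₁ p₂ b : ℂ) (ha : a ≠ 0) (hp₁ : p₁ ≠ 0) (hp₂ : p₂ ≠ 0) (hb : b ≠ 0)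
    (f : ℂ → ℂ) (hf : Differentiable ℂ f)
    (heq : ∀ z : ℂ, f z ^ n + a * (deriv f z) ^ n
        = p₁ * Complex.exp (b * z) + p₂ * Complex.exp (-b * z)) :
    {z : ℂ | f z = 0}.Infinite := by
  intro hfin
  have hn : n ≠ 0 := by omega
  have hne : ∃ z, f z ≠ 0 := by
    by_contra! h0
    obtain ⟨z, hz⟩ := exp_sum_exists_ne_zero (p₂ := p₂) hp₁ hb
    exact hz (by rw [← heq z, funext h0]; simp [hn])
  obtain ⟨P, F, hF, hF0, hPF⟩ := exists_eq_polynomial_mul_of_zeros_subset hfin.toFinset f hf hne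
    (fun z hz => by simpa using hz)
  obtain ⟨g, hg, hgF⟩ := exists_eq_exp_of_ne_zero hF hF0
  have hG' : ∀ z, deriv (fun z => -g z) z = 0 :=
    deriv_eq_zero_of_polynomial_mul_exp hn hp₁ hp₂ hb hg.neg
      (fun z => by rw [hPF, hgF, neg_neg]) heq
  have hgc : ∀ z, g z = g 0 := fun z =>
    neg_injective (is_const_of_deriv_eq_zero hg.neg hG' z 0)
  set Q := P * Polynomial.C (exp (g 0))
  have hQ : ∀ z, f z = Q.eval z := fun z => by
    rw [hPF, hgF, hgc, Polynomial.eval_mul, Polynomial.eval_C]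
  refine exp_sum_ne_polynomial (p₂ := p₂) hp₁ hb
    (Q ^ n + Polynomial.C a * Q.derivative ^ n) fun z => ?_
  rw [← heq, funext hQ, Polynomial.deriv]
  simp
end

section
/- Let a, p₁, p₂, b be nonzero complex constants. If f is an entire function satisfying f(z)⁴ + a·(f'(z))⁴ = p₁·e^{bz} + p₂·e^{−bz} for all z ∈ ℂ, then f''(z) = (b²/4)·f(z) for all z ∈ ℂ. -/
open Complex

open Filter Topology Metric

/-- `f` grows at most exponentially: `‖f z‖ ≤ exp (K * (1 + ‖z‖))` for some constant `K`. -/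
def IsExpType (f : ℂ → ℂ) : Prop :=
  ∃ K : ℝ, 0 ≤ K ∧ ∀ z, ‖f z‖ ≤ Real.exp (K * (1 + ‖z‖))

namespace IsExpType

variable {f g : ℂ → ℂ}

theorem const (c : ℂ) : IsExpType fun _ => c := by
  refine ⟨‖c‖, norm_nonneg _, fun z => ?_⟩
  have h := Real.add_one_le_exp (‖c‖ * (1 + ‖z‖))
  nlinarith [norm_nonneg c, norm_nonneg z, mul_nonneg (norm_nonneg c) (norm_nonneg z)]

theorem mul (hf : IsExpType f) (hg : IsExpType g) : IsExpType fun z => f z * g z := by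
  obtain ⟨K, hK, hf⟩ := hf
  obtain ⟨L, hL, hg⟩ := hg
  refine ⟨K + L, by positivity, fun z => ?_⟩
  rw [norm_mul, add_mul, Real.exp_add]
  exact mul_le_mul (hf z) (hg z) (norm_nonneg _) (Real.exp_pos _).le

theorem add (hf : IsExpType f) (hg : IsExpType g) : IsExpType fun z => f z + g z := by
  obtain ⟨K, hK, hf⟩ := hf
  obtain ⟨L, hL, hg⟩ := hg
  refine ⟨K + L + 1, by positivity, fun z => ?_⟩
  have hz := norm_nonneg z
  have h1 : Real.exp (K * (1 + ‖z‖)) ≤ Real.exp ((K + L) * (1 + ‖z‖)) := by gcongr; linarith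
  have h2 : Real.exp (L * (1 + ‖z‖)) ≤ Real.exp ((K + L) * (1 + ‖z‖)) := by gcongr; linarith
  have h3 : (2 : ℝ) ≤ Real.exp (1 + ‖z‖) := by linarith [Real.add_one_le_exp (1 + ‖z‖)]
  calc ‖f z + g z‖ ≤ ‖f z‖ + ‖g z‖ := norm_add_le _ _
    _ ≤ Real.exp ((K + L) * (1 + ‖z‖)) * 2 := by linarith [hf z, hg z]
    _ ≤ Real.exp ((K + L) * (1 + ‖z‖)) * Real.exp (1 + ‖z‖) := by gcongr
    _ = _ := by rw [← Real.exp_add]; ring_nf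

theorem const_mul (c : ℂ) (hf : IsExpType f) : IsExpType fun z => c * f z := (const c).mul hf

theorem sub (hf : IsExpType f) (hg : IsExpType g) : IsExpType fun z => f z - g z := by
  simpa [sub_eq_add_neg] using hf.add (hg.const_mul (-1))

theorem pow (hf : IsExpType f) (n : ℕ) : IsExpType fun z => f z ^ n := by
  induction n with
  | zero => simpa using const 1
  | succ n ih => simpa [pow_succ] using ih.mul hf

theorem deriv (hf : IsExpType f) (hd : Differentiable ℂ f) : IsExpType (deriv f) := by
  obtain ⟨K, hK, hf⟩ := hf
  refine ⟨2 * K, by positivity, fun z => ?_⟩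
  have h := norm_deriv_le_of_forall_mem_sphere_norm_le (c := z) (R := 1)
    (C := Real.exp (2 * K * (1 + ‖z‖))) one_pos hd.diffContOnCl fun w hw => ?_
  · simpa using h
  · refine (hf w).trans (Real.exp_le_exp.2 ?_)
    have h1 : ‖w‖ ≤ ‖z‖ + 1 := by
      have := norm_le_norm_add_norm_sub' w z
      rw [mem_sphere_iff_norm.1 hw] at this
      exact this
    nlinarith [norm_nonneg z]

/-- An entire function whose derivative is bounded by a multiple of `‖f z‖ + exp (B * ‖z‖)` has
exponential type, by Grönwall's inequality along rays. -/
theorem of_norm_deriv_le (hd : Differentiable ℂ f) {A B : ℝ} (hA : 0 < A) (hB : 0 ≤ B)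
    (h : ∀ z, ‖_root_.deriv f z‖ ≤ A * (‖f z‖ + Real.exp (B * ‖z‖))) : IsExpType f := by
  refine ⟨‖f 0‖ + A + B, by positivity, fun z => ?_⟩
  rcases eq_or_ne z 0 with rfl | hz
  · have := Real.add_one_le_exp ((‖f 0‖ + A + B) * (1 + ‖(0 : ℂ)‖))
    simp only [norm_zero, add_zero, mul_one] at this ⊢
    linarith
  have hz' : 0 < ‖z‖ := norm_pos_iff.2 hz
  have hder (t : ℝ) : HasDerivAt (fun t : ℝ => f (t * z)) (_root_.deriv f (t * z) * z) t := by
    have h1 : HasDerivAt (fun s : ℂ => s * z) z (t : ℂ) := by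
      simpa using (hasDerivAt_id (t : ℂ)).mul_const z
    exact ((hd (t * z)).hasDerivAt.comp (t : ℂ) h1).comp_ofReal
  have key := norm_le_gronwallBound_of_norm_deriv_right_le (f := fun t : ℝ => f (t * z))
    (f' := fun t : ℝ => _root_.deriv f (t * z) * z) (δ := ‖f 0‖) (K := A * ‖z‖)
    (ε := A * ‖z‖ * Real.exp (B * ‖z‖)) (a := 0) (b := 1)
    (fun t _ => (hder t).continuousAt.continuousWithinAt)
    (fun t _ => (hder t).hasDerivWithinAt) (by simp) ?_ 1 (by simp)
  · rw [gronwallBound_of_K_ne_0 (by positivity)] at key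
    have e : A * ‖z‖ * Real.exp (B * ‖z‖) / (A * ‖z‖) = Real.exp (B * ‖z‖) := by
      field_simp
    simp only [ofReal_one, one_mul, sub_zero, mul_one, e] at key
    have h1 : (1 : ℝ) ≤ Real.exp (B * ‖z‖) := Real.one_le_exp (by positivity)
    have h2 := Real.exp_pos (A * ‖z‖)
    have h3 := Real.add_one_le_exp ‖f 0‖
    calc ‖f z‖ ≤ (‖f 0‖ + 1) * Real.exp (A * ‖z‖) * Real.exp (B * ‖z‖) := by
          nlinarith [mul_nonneg (mul_nonneg (norm_nonneg (f 0)) h2.le) (sub_nonneg.2 h1)]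
      _ ≤ Real.exp ‖f 0‖ * Real.exp (A * ‖z‖) * Real.exp (B * ‖z‖) := by gcongr
      _ = Real.exp (‖f 0‖ + A * ‖z‖ + B * ‖z‖) := by rw [Real.exp_add, Real.exp_add]
      _ ≤ _ := by
          refine Real.exp_le_exp.2 ?_
          nlinarith [mul_nonneg (norm_nonneg (f 0)) hz'.le]
  · intro t ht
    have ht1 : ‖(t : ℂ) * z‖ ≤ ‖z‖ := by
      rw [norm_mul, norm_real, Real.norm_of_nonneg ht.1]
      nlinarith [ht.2]
    rw [norm_mul]
    calc ‖_root_.deriv f (t * z)‖ * ‖z‖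
        ≤ (A * (‖f (t * z)‖ + Real.exp (B * ‖(t : ℂ) * z‖))) * ‖z‖ := by gcongr; exact h _
      _ ≤ (A * (‖f (t * z)‖ + Real.exp (B * ‖z‖))) * ‖z‖ := by gcongr
      _ = _ := by ring

end IsExpType

/-- A Harnack-type inequality for zero-free holomorphic functions. -/
theorem norm_le_of_ne_zero_on_ball {g : ℂ → ℂ} (hd : Differentiable ℂ g) {z₀ : ℂ} {R L : ℝ}
    (hR : 2 ≤ R) (hL : 0 < L) (h0 : ∀ w ∈ ball z₀ R, g w ≠ 0)
    (hb : ∀ w ∈ ball z₀ R, ‖g w‖ ≤ Real.exp L * ‖g z₀‖) {w : ℂ} (hw : ‖w - z₀‖ ≤ 1) :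
    ‖g w‖ ≤ Real.exp (4 * L / R) * ‖g z₀‖ := by
  have hR0 : 0 < R := by linarith
  have hz₀ : z₀ ∈ ball z₀ R := mem_ball_self hR0
  have hq : DifferentiableOn ℂ (fun w => deriv g w / g w) (ball z₀ R) :=
    hd.deriv.differentiableOn.div hd.differentiableOn h0
  obtain ⟨h, hh0, hh⟩ := hq.isExactOn_ball.with_val_at z₀ 0
  have hexp : ∀ w ∈ ball z₀ R, g w = g z₀ * exp (h w) := by
    have hder : ∀ w ∈ ball z₀ R, HasDerivAt (fun w => g w * exp (-h w)) 0 w := by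
      intro w hw
      have := (hd w).hasDerivAt.mul (hh w hw).neg.cexp
      refine this.congr_deriv ?_
      have := h0 w hw
      simp only [Pi.neg_apply]
      field_simp
      ring
    intro w hw
    have hc := (convex_ball z₀ R).is_const_of_fderivWithin_eq_zero (𝕜 := ℂ)
      (f := fun w => g w * exp (-h w))
      (fun w hw => (hder w hw).differentiableAt.differentiableWithinAt)
      (fun w hw => by
        rw [fderivWithin_of_isOpen isOpen_ball hw]
        ext
        simpa using (hder w hw).deriv) hw hz₀
    simp only [hh0, neg_zero, exp_zero, mul_one] at hc
    rw [← hc, mul_assoc, ← exp_add]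
    simp
  have hre : ∀ w ∈ ball z₀ R, (h w).re ≤ L := by
    intro w hw
    have h1 := hb w hw
    rw [hexp w hw, norm_mul, norm_exp, mul_comm] at h1
    exact Real.exp_le_exp.1 (le_of_mul_le_mul_right h1 (norm_pos_iff.2 (h0 z₀ hz₀)))
  have hmem : w ∈ ball z₀ R := by rw [mem_ball_iff_norm]; linarith
  have hmap : Set.MapsTo (fun x => z₀ + x) (ball 0 R) (ball z₀ R) := fun x hx => by
    simpa [mem_ball_iff_norm] using hx
  have hBC := borelCaratheodory_zero (f := fun x => h (z₀ + x)) (M := L) (R := R)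
    (z := w - z₀) hL
    (fun x hx => ((hh _ (hmap hx)).differentiableAt.comp x
      (by fun_prop)).differentiableWithinAt)
    (fun x hx => hre _ (hmap hx)) hR0 (mem_ball_zero_iff.2 (mem_ball_iff_norm.1 hmem))
    (by simpa using hh0)
  simp only [add_sub_cancel] at hBC
  have hbound : 2 * L * ‖w - z₀‖ / (R - ‖w - z₀‖) ≤ 4 * L / R := by
    rw [div_le_div_iff₀ (by linarith) hR0]
    nlinarith [mul_nonneg hL.le (sub_nonneg.2 hw),
      mul_nonneg (mul_nonneg hL.le (sub_nonneg.2 hw)) hR0.le, mul_nonneg hL.le (sub_nonneg.2 hR)]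
  rw [hexp w hmem, norm_mul, norm_exp, mul_comm]
  gcongr
  exact (re_le_norm _).trans (hBC.trans hbound)

/-- Along a ray pointing into a half-plane where `g * h` is bounded below, a function `g` of
exponential type is comparable at distance at most one. -/
theorem IsExpType.exists_norm_le_along_ray {g h : ℂ → ℂ} (hd : Differentiable ℂ g)
    (hg : IsExpType g) (hh : IsExpType h) {b ω : ℂ} (hω : 0 < (b * ω).re) {S : ℝ}
    (hgh : ∀ w, S ≤ (b * w).re → 1 ≤ ‖g w * h w‖) :
    ∃ C : ℝ, 0 < C ∧ ∀ᶠ t : ℝ in atTop, ∀ w, ‖w - t * ω‖ ≤ 1 → ‖g w‖ ≤ C * ‖g (t * ω)‖ := by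
  obtain ⟨K, hK, hg⟩ := hg
  obtain ⟨K', hK', hh⟩ := hh
  have hb : b ≠ 0 := by rintro rfl; simp at hω
  have hb' : 0 < ‖b‖ := norm_pos_iff.2 hb
  set c := (b * ω).re with hc
  set r := c / (2 * ‖b‖) with hr
  have hr0 : 0 < r := by positivity
  set D := K * (1 + ‖ω‖ + r) + K' * (1 + ‖ω‖) + 1 with hD
  have hD0 : 0 < D := by positivity
  refine ⟨Real.exp (4 * D / r), Real.exp_pos _, ?_⟩
  filter_upwards [eventually_ge_atTop 1, eventually_ge_atTop (2 / r),
    eventually_ge_atTop (2 * S / c)] with t ht1 htr htS w hw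
  have ht0 : 0 < t := by linarith
  have htω : ‖(t : ℂ) * ω‖ = t * ‖ω‖ := by
    rw [norm_mul, norm_real, Real.norm_of_nonneg ht0.le]
  rw [div_le_iff₀ hω] at htS
  have hreal : ∀ w ∈ ball ((t : ℂ) * ω) (r * t), S ≤ (b * w).re := by
    intro w hw
    rw [mem_ball_iff_norm] at hw
    have e : (b * w).re = c * t + (b * (w - t * ω)).re := by
      have : b * w = t * (b * ω) + b * (w - t * ω) := by ring
      rw [this, add_re, re_ofReal_mul, hc]
      ring
    have h1 : |(b * (w - t * ω)).re| ≤ ‖b‖ * (r * t) := by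
      refine (abs_re_le_norm _).trans ?_
      rw [norm_mul]
      gcongr
    have h2 : ‖b‖ * (r * t) = c * t / 2 := by rw [hr]; field_simp
    have := (abs_le.1 h1).1
    linarith
  have hmem : (t : ℂ) * ω ∈ ball ((t : ℂ) * ω) (r * t) := mem_ball_self (by positivity)
  have hz := hgh _ (hreal _ hmem)
  have key := norm_le_of_ne_zero_on_ball hd (z₀ := t * ω) (R := r * t) (L := D * t)
    (by rw [div_le_iff₀ hr0] at htr; linarith) (by positivity)
    (fun w hw h0 => by
      have := hgh w (hreal w hw)
      simp [h0] at this
      linarith) ?_ hw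
  · have e : 4 * (D * t) / (r * t) = 4 * D / r := by field_simp
    rwa [e] at key
  · intro w hw
    rw [mem_ball_iff_norm] at hw
    have hwn : ‖w‖ ≤ t * ‖ω‖ + r * t := by
      have := norm_le_norm_add_norm_sub' w (t * ω)
      rw [htω] at this
      linarith
    calc ‖g w‖ = ‖g w‖ * 1 := (mul_one _).symm
      _ ≤ ‖g w‖ * ‖g (t * ω) * h (t * ω)‖ := by gcongr
      _ = (‖g w‖ * ‖h (t * ω)‖) * ‖g (t * ω)‖ := by rw [norm_mul]; ring
      _ ≤ (Real.exp (K * (1 + ‖w‖)) * Real.exp (K' * (1 + ‖(t : ℂ) * ω‖))) * ‖g (t * ω)‖ := by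
          gcongr
          · exact hg w
          · exact hh _
      _ ≤ Real.exp (D * t) * ‖g (t * ω)‖ := by
          rw [← Real.exp_add, htω]
          gcongr
          have h1 : K * (1 + ‖w‖) ≤ K * ((1 + ‖ω‖ + r) * t) := by gcongr; linarith
          have h2 : K' * (1 + t * ‖ω‖) ≤ K' * ((1 + ‖ω‖) * t) := by gcongr; linarith
          rw [hD]
          linarith

theorem exists_le_norm_exp_add_exp {p₁ : ℂ} (hp₁ : p₁ ≠ 0) (p₂ b : ℂ) (B : ℝ) :
    ∃ S, ∀ w, S ≤ (b * w).re → B ≤ ‖p₁ * exp (b * w) + p₂ * exp (-b * w)‖ := by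
  have hp : 0 < ‖p₁‖ := norm_pos_iff.2 hp₁
  refine ⟨max 0 ((B + ‖p₂‖) / ‖p₁‖), fun w hw => ?_⟩
  have h0 : 0 ≤ (b * w).re := (le_max_left _ _).trans hw
  have h1 : (B + ‖p₂‖) ≤ (b * w).re * ‖p₁‖ := (div_le_iff₀ hp).1 ((le_max_right _ _).trans hw)
  have h2 := norm_sub_le_norm_add (p₁ * exp (b * w)) (p₂ * exp (-b * w))
  have h3 := Real.add_one_le_exp (b * w).re
  have h4 : Real.exp (-(b * w).re) ≤ 1 := Real.exp_le_one_iff.2 (by linarith)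
  rw [norm_mul, norm_mul, norm_exp, norm_exp, neg_mul, neg_re] at h2
  rw [neg_mul]
  nlinarith [norm_nonneg p₂]

theorem bounded_on_ray {g : ℝ → ℂ} (hc : Continuous g) (h : Tendsto g atTop (𝓝 0)) :
    ∃ C, ∀ x, 0 ≤ x → ‖g x‖ ≤ C := by
  have h1 : ∀ᶠ x in atTop, ‖g x‖ < 1 := by
    have := h.norm
    rw [norm_zero] at this
    exact this.eventually_lt_const one_pos
  obtain ⟨T, hT⟩ := eventually_atTop.1 h1
  obtain ⟨C, hC⟩ := (isCompact_Icc (a := 0) (b := T)).exists_bound_of_continuousOn hc.continuousOn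
  refine ⟨max C 1, fun x hx => ?_⟩
  rcases le_total x T with hxT | hxT
  · exact (hC x ⟨hx, hxT⟩).trans (le_max_left _ _)
  · exact (hT x hxT).le.trans (le_max_right _ _)

theorem IsExpType.isBigO {f : ℂ → ℂ} (hf : IsExpType f) (s : Set ℂ) :
    ∃ c < (2 : ℝ), ∃ B : ℝ,
      f =O[Bornology.cobounded ℂ ⊓ 𝓟 s] fun z => Real.exp (B * ‖z‖ ^ c) := by
  obtain ⟨K, -, hf⟩ := hf
  refine ⟨1, by norm_num, K, Asymptotics.IsBigO.of_bound (Real.exp K) (Eventually.of_forall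
    fun z => ?_)⟩
  rw [Real.rpow_one, Real.norm_of_nonneg (Real.exp_pos _).le, ← Real.exp_add]
  exact (hf z).trans_eq (by ring_nf)

/-- A function of exponential type tending to zero along the four half-axes vanishes. -/
theorem IsExpType.eq_zero_of_tendsto {φ : ℂ → ℂ} (hd : Differentiable ℂ φ) (hφ : IsExpType φ)
    (h1 : Tendsto (fun t : ℝ => φ t) atTop (𝓝 0))
    (h2 : Tendsto (fun t : ℝ => φ (t * I)) atTop (𝓝 0))
    (h3 : Tendsto (fun t : ℝ => φ (t * (-1))) atTop (𝓝 0))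
    (h4 : Tendsto (fun t : ℝ => φ (t * (-I))) atTop (𝓝 0)) (z : ℂ) : φ z = 0 := by
  have hc := hd.continuous
  obtain ⟨C₁, h1'⟩ := bounded_on_ray (by fun_prop) h1
  obtain ⟨C₂, h2'⟩ := bounded_on_ray (by fun_prop) h2
  obtain ⟨C₃, h3'⟩ := bounded_on_ray (by fun_prop) h3
  obtain ⟨C₄, h4'⟩ := bounded_on_ray (by fun_prop) h4
  set C := max (max C₁ C₂) (max C₃ C₄)
  have b1 : ∀ x : ℝ, 0 ≤ x → ‖φ x‖ ≤ C := fun x hx =>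
    (h1' x hx).trans ((le_max_left _ _).trans (le_max_left _ _))
  have b2 : ∀ x : ℝ, 0 ≤ x → ‖φ (x * I)‖ ≤ C := fun x hx =>
    (h2' x hx).trans ((le_max_right _ _).trans (le_max_left _ _))
  have b3 : ∀ x : ℝ, x ≤ 0 → ‖φ x‖ ≤ C := fun x hx => by
    have : ‖φ ((-x : ℝ) * (-1))‖ ≤ C :=
      (h3' (-x) (by linarith)).trans ((le_max_left _ _).trans (le_max_right _ _))
    simpa using this
  have b4 : ∀ x : ℝ, x ≤ 0 → ‖φ (x * I)‖ ≤ C := fun x hx => by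
    have : ‖φ ((-x : ℝ) * (-I))‖ ≤ C :=
      (h4' (-x) (by linarith)).trans ((le_max_right _ _).trans (le_max_right _ _))
    simpa using this
  have hb : ∀ z, ‖φ z‖ ≤ C := by
    intro z
    rcases le_total 0 z.re with hr | hr <;> rcases le_total 0 z.im with hi | hi
    · exact PhragmenLindelof.quadrant_I hd.diffContOnCl (hφ.isBigO _) b1 b2 hr hi
    · exact PhragmenLindelof.quadrant_IV hd.diffContOnCl (hφ.isBigO _) b1 b4 hr hi
    · exact PhragmenLindelof.quadrant_II hd.diffContOnCl (hφ.isBigO _) b3 b2 hr hi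
    · exact PhragmenLindelof.quadrant_III hd.diffContOnCl (hφ.isBigO _) b3 b4 hr hi
  obtain ⟨c, hc⟩ := hd.exists_eq_const_of_bounded
    (isBounded_iff_forall_norm_le.2 ⟨C, by rintro _ ⟨z, rfl⟩; exact hb z⟩)
  subst hc
  exact tendsto_nhds_unique tendsto_const_nhds h1

/-- The auxiliary quotient `φ` decays along rays in the half-plane `0 < re (b * ω)`. -/
theorem tendsto_zero_along_ray {a p₁ p₂ b ω : ℂ} (hp₁ : p₁ ≠ 0) {f φ : ℂ → ℂ}
    (hf : Differentiable ℂ f) (hexp : IsExpType f)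
    (heq : ∀ z, f z ^ 4 + a * (deriv f z) ^ 4 = p₁ * exp (b * z) + p₂ * exp (-b * z))
    (h₁ : ∀ z, φ z * f z ^ 3 = 12 * f z ^ 2 + 12 * a * (deriv (deriv f) z) ^ 2
      + 4 * a * deriv f z * deriv (deriv (deriv f)) z - a * b ^ 2 * (deriv f z) ^ 2)
    (h₂ : ∀ z, φ z * (deriv f z) ^ 2 = b ^ 2 * f z - 4 * deriv (deriv f) z)
    (hω : 0 < (b * ω).re) : Tendsto (fun t : ℝ => φ (t * ω)) atTop (𝓝 0) := by
  obtain ⟨α, hα⟩ := IsAlgClosed.exists_pow_nat_eq (-a) (n := 4) (by norm_num)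
  have hf' := hf.deriv
  have hexp' := hexp.deriv hf
  obtain ⟨S, hS⟩ := exists_le_norm_exp_add_exp hp₁ p₂ b 1
  obtain ⟨C₁, hC₁, hg₁⟩ := IsExpType.exists_norm_le_along_ray
    (g := fun z => f z - α * deriv f z)
    (h := fun z => (f z + α * deriv f z) * (f z ^ 2 + α ^ 2 * deriv f z ^ 2))
    (by fun_prop) (hexp.sub (hexp'.const_mul α))
    ((hexp.add (hexp'.const_mul α)).mul ((hexp.pow 2).add ((hexp'.pow 2).const_mul _)))
    hω (S := S) (fun w hw => by
      refine (hS w hw).trans_eq (congrArg norm ?_)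
      linear_combination -heq w + (deriv f w) ^ 4 * hα)
  obtain ⟨C₂, hC₂, hg₂⟩ := IsExpType.exists_norm_le_along_ray
    (g := fun z => f z + α * deriv f z)
    (h := fun z => (f z - α * deriv f z) * (f z ^ 2 + α ^ 2 * deriv f z ^ 2))
    (by fun_prop) (hexp.add (hexp'.const_mul α))
    ((hexp.sub (hexp'.const_mul α)).mul ((hexp.pow 2).add ((hexp'.pow 2).const_mul _)))
    hω (S := S) (fun w hw => by
      refine (hS w hw).trans_eq (congrArg norm ?_)
      linear_combination -heq w + (deriv f w) ^ 4 * hα)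
  set m : ℝ → ℝ := fun t => ‖f (t * ω)‖ + ‖deriv f (t * ω)‖ with hm
  have hm_top : Tendsto m atTop atTop := by
    refine tendsto_atTop.2 fun B => ?_
    obtain ⟨S', hS'⟩ := exists_le_norm_exp_add_exp hp₁ p₂ b ((1 + ‖a‖) * |B| ^ 4)
    filter_upwards [eventually_ge_atTop (S' / (b * ω).re)] with t ht
    have h := hS' (t * ω) (by
      rw [div_le_iff₀ hω] at ht
      rwa [show b * (t * ω) = t * (b * ω) by ring, re_ofReal_mul])
    have h1 : ‖f (t * ω)‖ ≤ m t := le_add_of_nonneg_right (norm_nonneg _)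
    have h2 : ‖deriv f (t * ω)‖ ≤ m t := le_add_of_nonneg_left (norm_nonneg _)
    rw [← heq] at h
    have h3 : ‖f (t * ω) ^ 4 + a * deriv f (t * ω) ^ 4‖ ≤ (1 + ‖a‖) * m t ^ 4 := by
      calc _ ≤ ‖f (t * ω)‖ ^ 4 + ‖a‖ * ‖deriv f (t * ω)‖ ^ 4 := by
            rw [← norm_pow, ← norm_pow, ← norm_mul]
            exact norm_add_le _ _
        _ ≤ m t ^ 4 + ‖a‖ * m t ^ 4 := by gcongr
        _ = _ := by ring
    have h4 := le_of_mul_le_mul_left (h.trans h3) (by positivity)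
    exact (le_abs_self B).trans (le_of_pow_le_pow_left₀ (by norm_num) (by positivity) h4)
  set C := (C₁ + C₂) * (1 + ‖α‖) with hC
  have hC0 : 0 ≤ C := by positivity
  set Q := 8 * (12 + 48 * ‖a‖ * C ^ 2 + 24 * ‖a‖ * C + ‖a‖ * ‖b‖ ^ 2) + 4 * (‖b‖ ^ 2 + 8 * C)
    with hQ
  refine squeeze_zero_norm' (a := fun t => Q / m t) ?_ (tendsto_const_nhds.div_atTop hm_top)
  filter_upwards [hg₁, hg₂, hm_top.eventually_gt_atTop 0] with t ht₁ ht₂ hmt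
  set z : ℂ := t * ω
  have hfm : ‖f z‖ ≤ m t := le_add_of_nonneg_right (norm_nonneg _)
  have hfm' : ‖deriv f z‖ ≤ m t := le_add_of_nonneg_left (norm_nonneg _)
  have hα' : ‖f z‖ + ‖α‖ * ‖deriv f z‖ ≤ (1 + ‖α‖) * m t := by
    nlinarith [mul_le_mul_of_nonneg_left hfm' (norm_nonneg α)]
  have hnear : ∀ w ∈ sphere z 1, ‖f w‖ ≤ C * m t := by
    intro w hw
    have hw' : ‖w - z‖ ≤ 1 := (mem_sphere_iff_norm.1 hw).le
    have e1 := ht₁ w hw'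
    have e2 := ht₂ w hw'
    have e3 : ‖f z - α * deriv f z‖ ≤ (1 + ‖α‖) * m t :=
      (norm_sub_le _ _).trans (by rwa [norm_mul])
    have e4 : ‖f z + α * deriv f z‖ ≤ (1 + ‖α‖) * m t :=
      (norm_add_le _ _).trans (by rwa [norm_mul])
    have e5 : 2 * ‖f w‖ ≤ ‖f w - α * deriv f w‖ + ‖f w + α * deriv f w‖ := by
      have := norm_add_le (f w - α * deriv f w) (f w + α * deriv f w)
      rwa [show f w - α * deriv f w + (f w + α * deriv f w) = 2 * f w by ring, norm_mul,
        norm_ofNat] at this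
    have e6 := mul_le_mul_of_nonneg_left e3 hC₁.le
    have e7 := mul_le_mul_of_nonneg_left e4 hC₂.le
    rw [hC]
    linarith [norm_nonneg (f w)]
  have hd2 : ‖deriv (deriv f) z‖ ≤ 2 * (C * m t) := by
    have := norm_iteratedDeriv_le_of_forall_mem_sphere_norm_le 2 one_pos hf.diffContOnCl hnear
    simpa [iteratedDeriv_succ, Nat.factorial] using this
  have hd3 : ‖deriv (deriv (deriv f)) z‖ ≤ 6 * (C * m t) := by
    have := norm_iteratedDeriv_le_of_forall_mem_sphere_norm_le 3 one_pos hf.diffContOnCl hnear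
    simpa [iteratedDeriv_succ, Nat.factorial] using this
  have n1 : ‖φ z‖ * ‖f z‖ ^ 3
      ≤ (12 + 48 * ‖a‖ * C ^ 2 + 24 * ‖a‖ * C + ‖a‖ * ‖b‖ ^ 2) * m t ^ 2 := by
    rw [← norm_pow, ← norm_mul, h₁]
    calc _ ≤ ‖12 * f z ^ 2‖ + ‖12 * a * (deriv (deriv f) z) ^ 2‖
          + ‖4 * a * deriv f z * deriv (deriv (deriv f)) z‖ + ‖a * b ^ 2 * (deriv f z) ^ 2‖ :=
          (norm_sub_le _ _).trans (by gcongr; exact norm_add₃_le)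
      _ = 12 * ‖f z‖ ^ 2 + 12 * ‖a‖ * ‖deriv (deriv f) z‖ ^ 2
          + 4 * ‖a‖ * ‖deriv f z‖ * ‖deriv (deriv (deriv f)) z‖
          + ‖a‖ * ‖b‖ ^ 2 * ‖deriv f z‖ ^ 2 := by simp
      _ ≤ 12 * m t ^ 2 + 12 * ‖a‖ * (2 * (C * m t)) ^ 2
          + 4 * ‖a‖ * m t * (6 * (C * m t)) + ‖a‖ * ‖b‖ ^ 2 * m t ^ 2 := by gcongr
      _ = _ := by ring
  have n2 : ‖φ z‖ * ‖deriv f z‖ ^ 2 ≤ (‖b‖ ^ 2 + 8 * C) * m t := by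
    rw [← norm_pow, ← norm_mul, h₂]
    calc _ ≤ ‖b ^ 2 * f z‖ + ‖4 * deriv (deriv f) z‖ := norm_sub_le _ _
      _ = ‖b‖ ^ 2 * ‖f z‖ + 4 * ‖deriv (deriv f) z‖ := by simp
      _ ≤ ‖b‖ ^ 2 * m t + 4 * (2 * (C * m t)) := by gcongr
      _ = _ := by ring
  have hQ1 : 0 ≤ 12 + 48 * ‖a‖ * C ^ 2 + 24 * ‖a‖ * C + ‖a‖ * ‖b‖ ^ 2 := by positivity
  have hQ2 : 0 ≤ ‖b‖ ^ 2 + 8 * C := by positivity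
  generalize 12 + 48 * ‖a‖ * C ^ 2 + 24 * ‖a‖ * C + ‖a‖ * ‖b‖ ^ 2 = Q₁ at hQ n1 hQ1
  generalize ‖b‖ ^ 2 + 8 * C = Q₂ at hQ n2 hQ2
  rw [le_div_iff₀ hmt, hQ]
  have hmz : m t = ‖f z‖ + ‖deriv f z‖ := rfl
  rcases le_total ‖deriv f z‖ ‖f z‖ with hle | hle
  · have h3 : (m t / 2) ^ 3 ≤ ‖f z‖ ^ 3 := by gcongr; linarith
    have h4 := (mul_le_mul_of_nonneg_left h3 (norm_nonneg (φ z))).trans n1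
    have h5 : ‖φ z‖ * m t * m t ^ 2 ≤ 8 * Q₁ * m t ^ 2 := by linarith
    linarith [le_of_mul_le_mul_right h5 (by positivity)]
  · have h3 : (m t / 2) ^ 2 ≤ ‖deriv f z‖ ^ 2 := by gcongr; linarith
    have h4 := (mul_le_mul_of_nonneg_left h3 (norm_nonneg (φ z))).trans n2
    have h5 : ‖φ z‖ * m t * m t ≤ 4 * Q₂ * m t := by linarith
    linarith [le_of_mul_le_mul_right h5 (by positivity)]

theorem isExpType_of_pow_add_deriv_pow {a p₁ p₂ b : ℂ} (ha : a ≠ 0) {f : ℂ → ℂ}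
    (hf : Differentiable ℂ f)
    (heq : ∀ z, f z ^ 4 + a * (deriv f z) ^ 4 = p₁ * exp (b * z) + p₂ * exp (-b * z)) :
    IsExpType f := by
  have ha' : 0 < ‖a‖ := norm_pos_iff.2 ha
  set p := ‖p₁‖ + ‖p₂‖ + 1 with hp
  have hp0 : 0 < p := by positivity
  set A := p / ‖a‖ + 1 with hA
  have hA1 : 1 ≤ A := by rw [hA]; exact le_add_of_nonneg_left (by positivity)
  refine IsExpType.of_norm_deriv_le hf (A := A) (B := ‖b‖) (by positivity) (norm_nonneg b)
    fun z => ?_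
  set E := Real.exp (‖b‖ * ‖z‖) with hE
  have hE1 : 1 ≤ E := Real.one_le_exp (by positivity)
  have hEr : ∀ c : ℂ, ‖c‖ = ‖b‖ → ‖exp (c * z)‖ ≤ E := fun c hc => by
    refine (norm_exp_le_exp_norm _).trans ?_
    rw [norm_mul, hc]
  have h1 : ‖a‖ * ‖deriv f z‖ ^ 4 ≤ p * (‖f z‖ + E) ^ 4 := by
    calc ‖a‖ * ‖deriv f z‖ ^ 4
        = ‖p₁ * exp (b * z) + p₂ * exp (-b * z) - f z ^ 4‖ := by
          rw [← heq, ← norm_pow, ← norm_mul]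
          ring_nf
      _ ≤ ‖p₁‖ * ‖exp (b * z)‖ + ‖p₂‖ * ‖exp (-b * z)‖ + ‖f z‖ ^ 4 := by
          rw [← norm_mul, ← norm_mul, ← norm_pow]
          exact (norm_sub_le _ _).trans (by gcongr; exact norm_add_le _ _)
      _ ≤ ‖p₁‖ * E + ‖p₂‖ * E + ‖f z‖ ^ 4 := by
          gcongr
          · exact hEr b rfl
          · exact hEr (-b) (norm_neg b)
      _ ≤ ‖p₁‖ * (‖f z‖ + E) ^ 4 + ‖p₂‖ * (‖f z‖ + E) ^ 4 + (‖f z‖ + E) ^ 4 := by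
          have : E ≤ (‖f z‖ + E) ^ 4 := by
            have h2 : E ≤ ‖f z‖ + E := le_add_of_nonneg_left (norm_nonneg _)
            exact h2.trans (le_self_pow₀ (hE1.trans h2) (by norm_num))
          gcongr
          linarith
      _ = _ := by rw [hp]; ring
  refine le_of_pow_le_pow_left₀ (n := 4) (by norm_num) (by positivity) ?_
  rw [mul_pow]
  calc ‖deriv f z‖ ^ 4 ≤ p * (‖f z‖ + E) ^ 4 / ‖a‖ := by
        rw [le_div_iff₀ ha']; linarith
    _ = p / ‖a‖ * (‖f z‖ + E) ^ 4 := by ring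
    _ ≤ A ^ 4 * (‖f z‖ + E) ^ 4 := by
        gcongr
        exact (le_add_of_nonneg_right zero_le_one).trans (le_self_pow₀ hA1 (by norm_num))

theorem stmt_13 (a p₁ p₂ b : ℂ) (ha : a ≠ 0) (hp₁ : p₁ ≠ 0) (hp₂ : p₂ ≠ 0) (hb : b ≠ 0)
    (f : ℂ → ℂ) (hf : Differentiable ℂ f)
    (heq : ∀ z : ℂ, f z ^ 4 + a * (deriv f z) ^ 4
        = p₁ * Complex.exp (b * z) + p₂ * Complex.exp (-b * z)) :
    ∀ z : ℂ, deriv (deriv f) z = (b ^ 2 / 4) * f z := by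
  have hexp := isExpType_of_pow_add_deriv_pow ha hf heq
  have hf1 := hf.deriv
  have hf2 := hf1.deriv
  have hf3 := hf2.deriv
  have hexp1 := hexp.deriv hf
  have hexp2 := hexp1.deriv hf1
  have hexp3 := hexp2.deriv hf2
  have hE (c z : ℂ) : HasDerivAt (fun z => exp (c * z)) (exp (c * z) * c) z := by
    simpa using ((hasDerivAt_id z).const_mul c).cexp
  have heq1 : ∀ z, 4 * f z ^ 3 * deriv f z + 4 * a * deriv f z ^ 3 * deriv (deriv f) z
      = b * (p₁ * exp (b * z) - p₂ * exp (-b * z)) := by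
    intro z
    have hl := ((hf z).hasDerivAt.fun_pow 4).fun_add (((hf1 z).hasDerivAt.fun_pow 4).const_mul a)
    have hr := ((hE b z).const_mul p₁).fun_add ((hE (-b) z).const_mul p₂)
    rw [← funext heq] at hr
    have h := hl.unique hr
    push_cast at h
    linear_combination h
  have heq2 : ∀ z, 12 * f z ^ 2 * deriv f z ^ 2 + 4 * f z ^ 3 * deriv (deriv f) z
      + 12 * a * deriv f z ^ 2 * deriv (deriv f) z ^ 2
      + 4 * a * deriv f z ^ 3 * deriv (deriv (deriv f)) z
      = b ^ 2 * (p₁ * exp (b * z) + p₂ * exp (-b * z)) := by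
    intro z
    have hl := ((((hf z).hasDerivAt.fun_pow 3).const_mul 4).fun_mul (hf1 z).hasDerivAt).fun_add
      ((((hf1 z).hasDerivAt.fun_pow 3).const_mul (4 * a)).fun_mul (hf2 z).hasDerivAt)
    have hr := (((hE b z).const_mul p₁).fun_sub ((hE (-b) z).const_mul p₂)).const_mul b
    rw [← funext heq1] at hr
    have h := hl.unique hr
    push_cast at h
    linear_combination h
  have hXY : ∀ z, exp (b * z) * exp (-b * z) = 1 := fun z => by
    rw [← exp_add]
    simp
  set N₁ : ℂ → ℂ := fun z => 12 * f z ^ 2 + 12 * a * (deriv (deriv f) z) ^ 2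
      + 4 * a * (deriv f z * deriv (deriv (deriv f)) z) - a * b ^ 2 * (deriv f z) ^ 2 with hN₁
  set N₂ : ℂ → ℂ := fun z => b ^ 2 * f z - 4 * deriv (deriv f) z with hN₂
  set A : ℂ → ℂ := fun z => b ^ 2 * f z ^ 5 with hA
  set B : ℂ → ℂ := fun z => b ^ 2 * (2 * a * (f z ^ 4 * deriv f z ^ 2) + a ^ 2 * deriv f z ^ 6)
    - 16 * (f z ^ 3 + a * (deriv f z ^ 2 * deriv (deriv f) z)) ^ 2 with hB
  set κ := 4 * b ^ 2 * p₁ * p₂ with hκ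
  have hκ0 : κ ≠ 0 := by simp [hκ, hb, hp₁, hp₂]
  have hN : ∀ z, deriv f z ^ 2 * N₁ z = f z ^ 3 * N₂ z := fun z => by
    simp only [hN₁, hN₂]
    linear_combination heq2 z - b ^ 2 * heq z
  have hAB : ∀ z, f z ^ 3 * A z + deriv f z ^ 2 * B z = κ := fun z => by
    simp only [hA, hB, hκ]
    linear_combination b ^ 2 * (f z ^ 4 + a * (deriv f z) ^ 4
        + (p₁ * exp (b * z) + p₂ * exp (-b * z))) * heq z
      - (4 * f z ^ 3 * deriv f z + 4 * a * deriv f z ^ 3 * deriv (deriv f) z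
        + b * (p₁ * exp (b * z) - p₂ * exp (-b * z))) * heq1 z
      + 4 * b ^ 2 * p₁ * p₂ * hXY z
  set φ : ℂ → ℂ := fun z => κ⁻¹ * (A z * N₁ z + B z * N₂ z) with hφ
  have h₁ : ∀ z, φ z * f z ^ 3 = N₁ z := fun z => by
    simp only [hφ]
    field_simp
    linear_combination N₁ z * hAB z - B z * hN z
  have h₂ : ∀ z, φ z * deriv f z ^ 2 = N₂ z := fun z => by
    simp only [hφ]
    field_simp
    linear_combination N₂ z * hAB z + A z * hN z
  have hφd : Differentiable ℂ φ := by fun_prop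
  have hφexp : IsExpType φ := by
    have eN₁ : IsExpType N₁ := (((hexp.pow 2).const_mul _).add ((hexp2.pow 2).const_mul _)).add
      ((hexp1.mul hexp3).const_mul _) |>.sub ((hexp1.pow 2).const_mul _)
    have eN₂ : IsExpType N₂ := (hexp.const_mul _).sub (hexp2.const_mul _)
    have eA : IsExpType A := (hexp.pow 5).const_mul _
    have eB : IsExpType B :=
      (((((hexp.pow 4).mul (hexp1.pow 2)).const_mul _).add ((hexp1.pow 6).const_mul _)).const_mul
        _).sub ((((hexp.pow 3).add (((hexp1.pow 2).mul hexp2).const_mul _)).pow 2).const_mul _)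
    exact ((eA.mul eN₁).add (eB.mul eN₂)).const_mul _
  have hpos (ω : ℂ) (hω : 0 < (b * ω).re) : Tendsto (fun t : ℝ => φ (t * ω)) atTop (𝓝 0) :=
    tendsto_zero_along_ray hp₁ hf hexp heq (fun z => by rw [h₁, hN₁]; ring) h₂ hω
  have hneg (ω : ℂ) (hω : (b * ω).re < 0) : Tendsto (fun t : ℝ => φ (t * ω)) atTop (𝓝 0) :=
    tendsto_zero_along_ray (b := -b) hp₂ hf hexp
      (fun z => by rw [heq, neg_neg, add_comm]) (fun z => by rw [h₁, hN₁]; ring)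
      (fun z => by rw [h₂, hN₂]; ring) (by rw [neg_mul, neg_re]; linarith)
  set u := (1 + I) / b with hu
  have hu0 : u ≠ 0 := div_ne_zero (fun h => by simpa using congrArg re h) hb
  have hbu : ∀ c, b * (c * u) = (1 + I) * c := fun c => by rw [hu]; field_simp
  have hzero := IsExpType.eq_zero_of_tendsto (φ := fun z => φ (z * u)) (by fun_prop)
    (by
      obtain ⟨K, hK, hle⟩ := hφexp
      refine ⟨K * (1 + ‖u‖), by positivity, fun z => (hle _).trans (Real.exp_le_exp.2 ?_)⟩
      rw [norm_mul, mul_assoc]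
      gcongr
      nlinarith [norm_nonneg z, norm_nonneg u])
    (by simpa using hpos (1 * u) (by rw [hbu]; simp))
    (by simpa [mul_assoc] using hneg (I * u) (by rw [hbu]; simp))
    (by simpa [mul_assoc] using hneg (-1 * u) (by rw [hbu]; simp))
    (by simpa [mul_assoc] using hpos (-I * u) (by rw [hbu]; simp))
  intro z
  have hz := hzero (z / u)
  simp only [div_mul_cancel₀ z hu0] at hz
  have h := h₂ z
  rw [hz, hN₂] at h
  linear_combination (1 / 4 : ℂ) * h
end
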